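/- Assume the Riemann hypothesis. Then for every real t ≥ e^18 one has Re(ζ'/ζ(1 + i t)) ≤ 2 log log t + 1 − γ − log 4 + (8 log log t)/(log t) − 8.6/(log t), where ζ is the Riemann zeta-function and γ is the Euler–Mascheroni constant. -/

import Mathlib

open Complex
namespace ZRH
open MeasureTheory Filter Topology Set

lemma kernel_bound {b : ℝ} (hb : 0 < b) (x : ℝ) :
    √(1 + |x|) / (b ^ 2 + x ^ 2) ≤ 2 * (1 + 1 / b ^ 2) * (1 + ‖x‖) ^ (-(3/2) : ℝ) := by
  have h1 : 0 < 1 + |x| := by positivity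
  have h2 : 0 < b ^ 2 + x ^ 2 := by positivity
  rw [Real.norm_eq_abs, Real.sqrt_eq_rpow]
  have h3 : (1 + |x|) ^ (1/2 : ℝ) = (1 + |x|) ^ 2 * (1 + |x|) ^ (-(3/2) : ℝ) := by
    rw [← Real.rpow_natCast, ← Real.rpow_add h1]; norm_num
  rw [h3, mul_comm ((1 + |x|) ^ 2), mul_div_assoc, mul_comm]
  apply mul_le_mul_of_nonneg_right _ (by positivity)
  rw [div_le_iff₀ h2]
  have h4 : (1 + |x|) ^ 2 ≤ 2 + 2 * x ^ 2 := by
    rw [← sq_abs x]; nlinarith [sq_nonneg (1 - |x|)]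
  have h5 : 2 * (1 + 1 / b ^ 2) * (b ^ 2 + x ^ 2) = 2 * b^2 + 2 * x^2 + 2 + 2 * (x^2 / b^2) := by
    field_simp; ring
  rw [h5]
  have : 0 ≤ x^2 / b^2 := by positivity
  nlinarith [sq_nonneg b]

lemma kernel_integrable {b : ℝ} (hb : 0 < b) :
    Integrable (fun x : ℝ => √(1 + |x|) / (b ^ 2 + x ^ 2)) := by
  have h := (integrable_one_add_norm (E := ℝ) (μ := volume) (r := 3/2)
    (by simp; norm_num)).const_mul (2 * (1 + 1 / b ^ 2))
  refine h.mono' ?_ ?_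
  · apply Continuous.aestronglyMeasurable
    refine Continuous.div (by fun_prop) (by fun_prop) (fun x => by positivity)
  · filter_upwards with x
    rw [Real.norm_of_nonneg (by positivity)]
    exact kernel_bound hb x

lemma integral_kernel {b : ℝ} (hb : 0 < b) :
    ∫ x : ℝ, 1 / (b ^ 2 + x ^ 2) = Real.pi / b := by
  have h := Measure.integral_comp_div (fun y : ℝ => (1 + y ^ 2)⁻¹) b
  rw [integral_univ_inv_one_add_sq] at h
  have h2 : (fun x : ℝ => 1 / (b ^ 2 + x ^ 2)) = fun x => (b^2)⁻¹ * (1 + (x / b) ^ 2)⁻¹ := by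
    funext x
    have : (0:ℝ) < b^2 + x^2 := by positivity
    field_simp
  rw [h2, integral_const_mul, h, abs_of_pos hb]
  simp; field_simp

lemma line_integrable {b C : ℝ} (hb : 0 < b) {φ : ℝ → ℂ} (hc : Continuous φ)
    (hφ : ∀ x, ‖φ x‖ ≤ C * √(1 + |x|)) :
    Integrable (fun x : ℝ => φ x / ((b ^ 2 + x ^ 2 : ℝ) : ℂ)) := by
  refine ((kernel_integrable hb).const_mul C).mono' ?_ ?_
  · apply Continuous.aestronglyMeasurable
    refine Continuous.div hc (by fun_prop) (fun x => ?_)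
    have : (0:ℝ) < b^2 + x^2 := by positivity
    exact_mod_cast this.ne'
  · filter_upwards with x
    have : (0:ℝ) < b^2 + x^2 := by positivity
    rw [norm_div, Complex.norm_real, Real.norm_of_nonneg this.le, ← mul_div_assoc]
    gcongr
    exact hφ x

/-- Poisson/Cauchy formula in the right half-plane. -/
theorem poisson_right {Φ : ℂ → ℂ} {C b : ℝ} (hb : 0 < b)
    (hd : ∀ z : ℂ, 0 ≤ z.re → DifferentiableAt ℂ Φ z)
    (hg : ∀ z : ℂ, 0 ≤ z.re → ‖Φ z‖ ≤ C * √(1 + ‖z‖)) :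
    Integrable (fun x : ℝ => Φ (x * I) / ((b ^ 2 + x ^ 2 : ℝ) : ℂ)) ∧
    ∫ x : ℝ, Φ (x * I) / ((b ^ 2 + x ^ 2 : ℝ) : ℂ) = (Real.pi / b : ℝ) * Φ b := by
  have hcont : Continuous fun x : ℝ => Φ (x * I) := by
    rw [continuous_iff_continuousAt]
    intro x
    have := (hd (x * I) (by simp)).continuousAt
    exact ContinuousAt.comp (f := fun x : ℝ => (x * I : ℂ)) this (by fun_prop)
  have hintg : Integrable (fun x : ℝ => Φ (x * I) / ((b ^ 2 + x ^ 2 : ℝ) : ℂ)) := by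
    refine line_integrable (C := C) hb hcont (fun x => ?_)
    have := hg (x * I) (by simp)
    simpa using this
  refine ⟨hintg, ?_⟩
  have hC : 0 ≤ C := by
    have := (norm_nonneg _).trans (hg 0 (by simp))
    simpa using this
  have hint1 : Integrable (fun x : ℝ => Φ b / ((b ^ 2 + x ^ 2 : ℝ) : ℂ)) := by
    refine line_integrable (C := ‖Φ b‖) hb continuous_const (fun x => ?_)
    have : 1 ≤ √(1 + |x|) := by rw [Real.one_le_sqrt]; linarith [abs_nonneg x]
    nlinarith [norm_nonneg (Φ b)]
  set G : ℂ → ℂ := fun z => dslope Φ b z / (z + b) with hG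
  have hGd : DifferentiableOn ℂ G {z | 0 ≤ z.re} := by
    refine DifferentiableOn.div ?_ (by fun_prop) ?_
    · rw [Complex.differentiableOn_dslope]
      · exact fun z hz => (hd z hz).differentiableWithinAt
      · have : {z : ℂ | 0 < z.re} ∈ 𝓝 (b : ℂ) :=
          (isOpen_lt continuous_const continuous_re).mem_nhds (by simpa using hb)
        exact mem_of_superset this fun z hz => by simp only [mem_setOf_eq] at *; exact hz.le
    · intro z hz h
      have := congrArg re h
      simp at this hz
      linarith
  have hGline : ∀ x : ℝ, G (x * I) = - (Φ (x * I) / ((b ^ 2 + x ^ 2 : ℝ) : ℂ)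
      - Φ b / ((b ^ 2 + x ^ 2 : ℝ) : ℂ)) := by
    intro x
    have hne : (x * I : ℂ) ≠ b := by
      intro h; have := congrArg re h; simp at this; linarith
    have h1 : (x * I - b : ℂ) ≠ 0 := sub_ne_zero.mpr hne
    have h2 : (x * I + b : ℂ) ≠ 0 := by
      intro h; have := congrArg re h; simp at this; linarith
    have h3 : ((b ^ 2 + x ^ 2 : ℝ) : ℂ) = - ((x * I - b) * (x * I + b)) := by
      push_cast; ring_nf; simp
    rw [hG]; simp only
    rw [dslope_of_ne _ hne, slope_def_field, h3]
    field_simp; ring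
  have hGint : Integrable (fun x : ℝ => G (x * I)) := by
    simp_rw [hGline]; exact (hintg.sub hint1).neg
  have hGbound : ∀ R : ℝ, 2 * b ≤ R → ∀ z : ℂ, 0 ≤ z.re → R ≤ ‖z‖ → ‖z‖ ≤ 2 * R →
      ‖G z‖ ≤ (C * √(1 + 2 * R) + ‖Φ b‖) / (R / 2 * R) := by
    intro R hR z hz h1 h2
    have hRpos : 0 < R := by linarith
    have hzb : R / 2 ≤ ‖z - b‖ := by
      have := norm_sub_norm_le z (b : ℂ)
      rw [Complex.norm_real, Real.norm_of_nonneg hb.le] at this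
      linarith
    have hzb' : R ≤ ‖z + b‖ := by
      refine h1.trans ?_
      rw [← sq_le_sq₀ (norm_nonneg _) (norm_nonneg _), Complex.sq_norm, Complex.sq_norm,
        normSq_apply, normSq_apply]
      simp; nlinarith
    have hne : z ≠ b := by
      intro h; rw [h, sub_self, norm_zero] at hzb; linarith
    rw [hG]; simp only
    rw [dslope_of_ne _ hne, slope_def_field, div_div, norm_div, norm_mul]
    have h3 : ‖Φ z - Φ b‖ ≤ C * √(1 + 2 * R) + ‖Φ b‖ := by
      refine (norm_sub_le _ _).trans ?_
      gcongr
      refine (hg z hz).trans ?_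
      gcongr
    gcongr
  have hlim : Tendsto (fun R : ℝ => ∫ x in (-R)..R, G (x * I)) atTop (𝓝 (∫ x : ℝ, G (x * I))) :=
    intervalIntegral_tendsto_integral hGint tendsto_neg_atTop_atBot tendsto_id
  have hbd : ∀ R : ℝ, 2 * b ≤ R → ‖∫ x in (-R)..R, G (x * I)‖ ≤
      4 * R * ((C * √(1 + 2 * R) + ‖Φ b‖) / (R / 2 * R)) := by
    intro R hR
    have hRpos : 0 < R := by linarith
    have hrect := integral_boundary_rect_eq_zero_of_differentiableOn G (⟨0, -R⟩ : ℂ) (⟨R, R⟩ : ℂ)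
      (hGd.mono (by
        intro z hz
        have := hz.1
        simp [uIcc_of_le hRpos.le] at this
        exact this.1))
    simp only [ofReal_zero, zero_add, smul_eq_mul] at hrect
    have e1 : ‖∫ x in (0:ℝ)..R, G (x + (-R : ℝ) * I)‖ ≤
        ((C * √(1 + 2 * R) + ‖Φ b‖) / (R / 2 * R)) * |R - 0| := by
      apply intervalIntegral.norm_integral_le_of_norm_le_const
      intro x hx
      rw [uIoc_of_le hRpos.le] at hx
      have hx0 := hx.1; have hx1 := hx.2
      apply hGbound R hR
      · simp; linarith
      · refine le_trans ?_ (abs_im_le_norm _)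
        simp [abs_of_pos hRpos]
      · refine (norm_add_le _ _).trans ?_
        simp [abs_of_pos hRpos, abs_of_pos hx0]; linarith
    have e2 : ‖∫ x in (0:ℝ)..R, G (x + (R : ℝ) * I)‖ ≤
        ((C * √(1 + 2 * R) + ‖Φ b‖) / (R / 2 * R)) * |R - 0| := by
      apply intervalIntegral.norm_integral_le_of_norm_le_const
      intro x hx
      rw [uIoc_of_le hRpos.le] at hx
      have hx0 := hx.1; have hx1 := hx.2
      apply hGbound R hR
      · simp; linarith
      · refine le_trans ?_ (abs_im_le_norm _)
        simp [abs_of_pos hRpos]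
      · refine (norm_add_le _ _).trans ?_
        simp [abs_of_pos hRpos, abs_of_pos hx0]; linarith
    have e3 : ‖∫ y in (-R:ℝ)..R, G (R + (y : ℝ) * I)‖ ≤
        ((C * √(1 + 2 * R) + ‖Φ b‖) / (R / 2 * R)) * |R - (-R)| := by
      apply intervalIntegral.norm_integral_le_of_norm_le_const
      intro x hx
      rw [uIoc_of_le (by linarith)] at hx
      have hx0 := hx.1; have hx1 := hx.2
      apply hGbound R hR
      · simp; linarith
      · refine le_trans ?_ (abs_re_le_norm _)
        simp [abs_of_pos hRpos]
      · refine (norm_add_le _ _).trans ?_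
        have : |x| ≤ R := abs_le.mpr ⟨by linarith, hx1⟩
        simp [abs_of_pos hRpos]; linarith
    have e4 : I * ∫ x in (-R)..R, G (x * I) = (∫ x in (0:ℝ)..R, G (x + (-R : ℝ) * I))
        - (∫ x in (0:ℝ)..R, G (x + (R : ℝ) * I)) + I * ∫ y in (-R:ℝ)..R, G (R + (y : ℝ) * I) := by
      linear_combination -hrect
    have e5 : ‖∫ x in (-R)..R, G (x * I)‖ = ‖I * ∫ x in (-R)..R, G (x * I)‖ := by simp
    rw [e5, e4]
    refine (norm_add_le _ _).trans ?_
    refine (add_le_add (norm_sub_le _ _) le_rfl).trans ?_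
    rw [norm_mul, norm_I, one_mul]
    rw [sub_zero, abs_of_pos hRpos] at e1 e2
    rw [show R - -R = 2 * R by ring, abs_of_pos (by linarith)] at e3
    linarith
  have hz : ∫ x : ℝ, G (x * I) = 0 := by
    have hlim2 : Tendsto (fun R : ℝ => ∫ x in (-R)..R, G (x * I)) atTop (𝓝 0) := by
      have hT : Tendsto (fun R : ℝ => (8 * C * 2 + 8 * ‖Φ b‖) * (√R)⁻¹) atTop (𝓝 0) := by
        have := (tendsto_inv_atTop_zero.comp Real.tendsto_sqrt_atTop).const_mul
          (8 * C * 2 + 8 * ‖Φ b‖)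
        simpa using this
      refine squeeze_zero_norm' ?_ hT
      filter_upwards [eventually_ge_atTop (2 * b), eventually_ge_atTop 1] with R h1 h2
      refine (hbd R h1).trans ?_
      have hs : 0 < √R := Real.sqrt_pos.mpr (by linarith)
      have hs2 : √R * √R = R := Real.mul_self_sqrt (by linarith)
      have hs1 : 1 ≤ √R := by rw [Real.one_le_sqrt]; exact h2
      have h3 : √(1 + 2 * R) ≤ 2 * √R := by
        rw [show 2 * √R = √(4 * R) by
          rw [Real.sqrt_mul (by norm_num), show (4:ℝ) = 2^2 by norm_num, Real.sqrt_sq (by norm_num)]]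
        apply Real.sqrt_le_sqrt; linarith
      have h4 : 4 * R * ((C * √(1 + 2 * R) + ‖Φ b‖) / (R / 2 * R)) =
          8 * (C * √(1 + 2 * R) + ‖Φ b‖) / R := by
        have : R ≠ 0 := by linarith
        field_simp; ring
      rw [h4, div_le_iff₀ (by linarith)]
      have h5 : (8 * C * 2 + 8 * ‖Φ b‖) * (√R)⁻¹ * R = (8 * C * 2 + 8 * ‖Φ b‖) * √R := by
        nth_rewrite 2 [← hs2]; field_simp
      rw [h5]
      have := mul_le_mul_of_nonneg_left h3 hC
      nlinarith [norm_nonneg (Φ b)]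
    exact tendsto_nhds_unique hlim hlim2
  simp_rw [hGline] at hz
  rw [integral_neg, neg_eq_zero, integral_sub hintg hint1, sub_eq_zero] at hz
  rw [hz]
  have : (fun x : ℝ => Φ b / ((b ^ 2 + x ^ 2 : ℝ) : ℂ)) =
      fun x : ℝ => Φ b * ((1 / (b ^ 2 + x ^ 2) : ℝ) : ℂ) := by
    funext x; push_cast; ring
  have hK : ∫ x : ℝ, ((1 / (b ^ 2 + x ^ 2) : ℝ) : ℂ) = ((Real.pi / b : ℝ) : ℂ) := by
    rw [← integral_kernel hb]; exact integral_ofReal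
  rw [this, integral_const_mul, hK, mul_comm]

/-- Poisson/Cauchy formula in the left half-plane. -/
theorem poisson_left {Φ : ℂ → ℂ} {C b : ℝ} (hb : 0 < b)
    (hd : ∀ z : ℂ, z.re ≤ 0 → DifferentiableAt ℂ Φ z)
    (hg : ∀ z : ℂ, z.re ≤ 0 → ‖Φ z‖ ≤ C * √(1 + ‖z‖)) :
    Integrable (fun x : ℝ => Φ (x * I) / ((b ^ 2 + x ^ 2 : ℝ) : ℂ)) ∧
    ∫ x : ℝ, Φ (x * I) / ((b ^ 2 + x ^ 2 : ℝ) : ℂ) = (Real.pi / b : ℝ) * Φ (-b) := by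
  have h := poisson_right (Φ := fun z => Φ (-z)) (C := C) hb (fun z hz => by
      have := hd (-z) (by simpa using hz)
      exact DifferentiableAt.comp (f := fun z => -z) z this (by fun_prop))
    (fun z hz => by simpa using hg (-z) (by simpa using hz))
  obtain ⟨h1, h2⟩ := h
  have e : (fun x : ℝ => Φ (x * I) / ((b ^ 2 + x ^ 2 : ℝ) : ℂ)) =
      fun x : ℝ => (fun y : ℝ => Φ (-(y * I)) / ((b ^ 2 + y ^ 2 : ℝ) : ℂ)) (-x) := by
    funext x; simp
  constructor
  · rw [e]; exact h1.comp_neg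
  · rw [e, integral_neg_eq_self (fun y : ℝ => Φ (-(y * I)) / ((b ^ 2 + y ^ 2 : ℝ) : ℂ)) volume, h2]

end ZRH

namespace ZRH
open MeasureTheory Filter Topology Set

/-- terms of the series for `(s-1)ζ(s) - 1`. -/
noncomputable def zt (n : ℕ) (s : ℂ) : ℂ :=
  (s - 1) * ((n + 1 : ℝ) : ℂ) ^ (-s) + ((n + 2 : ℝ) : ℂ) ^ (1 - s) - ((n + 1 : ℝ) : ℂ) ^ (1 - s)

lemma hasDerivAt_cpow_real {x : ℝ} (hx : x ≠ 0) (r : ℂ) :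
    HasDerivAt (fun x : ℝ => (x : ℂ) ^ r) (r * (x : ℂ) ^ (r - 1)) x := by
  by_cases hr : r = 0
  · subst hr; simp [hasDerivAt_const]
  · exact hasDerivAt_ofReal_cpow_const hx hr

lemma zt_bound (n : ℕ) {s : ℂ} (hs : 0 < s.re) :
    ‖zt n s‖ ≤ ‖s‖ * ‖s - 1‖ * (n + 1 : ℝ) ^ (-s.re - 1) := by
  set m : ℝ := n + 1 with hm
  have hm0 : 0 < m := by positivity
  have h1 : ∀ x ∈ Icc m (m + 1), ‖(x : ℂ) ^ (-s) - (m : ℂ) ^ (-s)‖ ≤ ‖s‖ * m ^ (-s.re - 1) := by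
    intro x hx
    have := norm_image_sub_le_of_norm_deriv_le_segment' (f := fun x : ℝ => (x : ℂ) ^ (-s))
      (f' := fun x : ℝ => (-s) * (x : ℂ) ^ (-s - 1)) (a := m) (b := m + 1)
      (C := ‖s‖ * m ^ (-s.re - 1)) (fun x hx => by
        have hx0 : 0 < x := lt_of_lt_of_le hm0 hx.1
        exact (hasDerivAt_cpow_real hx0.ne' _).hasDerivWithinAt) (fun x hx => by
        have hx0 : 0 < x := lt_of_lt_of_le hm0 hx.1
        rw [norm_mul, norm_neg, norm_cpow_eq_rpow_re_of_pos hx0]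
        gcongr
        simp only [sub_re, neg_re, one_re]
        exact Real.rpow_le_rpow_of_nonpos hm0 hx.1 (by linarith)) x hx
    refine this.trans ?_
    have h2 : x - m ≤ 1 := by linarith [hx.2]
    have h3 : 0 ≤ ‖s‖ * m ^ (-s.re - 1) := by positivity
    nlinarith
  have h2 := norm_image_sub_le_of_norm_deriv_le_segment'
      (f := fun x : ℝ => (s - 1) * (m : ℂ) ^ (-s) * (x : ℂ) + (x : ℂ) ^ (1 - s))
      (f' := fun x : ℝ => (s - 1) * (m : ℂ) ^ (-s) + (1 - s) * (x : ℂ) ^ (1 - s - 1))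
      (a := m) (b := m + 1)
      (C := ‖s - 1‖ * (‖s‖ * m ^ (-s.re - 1))) (fun x hx => by
        have hx0 : 0 < x := lt_of_lt_of_le hm0 hx.1
        refine (HasDerivAt.add ?_ (hasDerivAt_cpow_real hx0.ne' _)).hasDerivWithinAt
        simpa using (Complex.ofRealCLM.hasDerivAt (x := x)).const_mul ((s - 1) * (m : ℂ) ^ (-s)))
      (fun x hx => by
        have e : (s - 1) * (m : ℂ) ^ (-s) + (1 - s) * (x : ℂ) ^ (1 - s - 1)
          = -(s - 1) * ((x : ℂ) ^ (-s) - (m : ℂ) ^ (-s)) := by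
          rw [show 1 - s - 1 = -s by ring]; ring
        rw [e, norm_mul, norm_neg]
        gcongr
        exact h1 x ⟨hx.1, hx.2.le⟩) (m + 1) ⟨by linarith, le_rfl⟩
  have e : zt n s = (s - 1) * (m : ℂ) ^ (-s) * ((m + 1 : ℝ) : ℂ) + ((m + 1 : ℝ) : ℂ) ^ (1 - s)
      - ((s - 1) * (m : ℂ) ^ (-s) * (m : ℂ) + (m : ℂ) ^ (1 - s)) := by
    rw [zt, ← hm, show (n + 2 : ℝ) = m + 1 by rw [hm]; ring]
    push_cast; ring
  rw [e]
  refine h2.trans (le_of_eq ?_)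
  ring

lemma zt_summable_aux : Summable fun n : ℕ => (n + 1 : ℝ) ^ (-(9/8) : ℝ) := by
  have := (Real.summable_nat_rpow (p := -(9/8))).mpr (by norm_num)
  exact_mod_cast (summable_nat_add_iff 1).mpr this

lemma zt_bound' (n : ℕ) {s : ℂ} (hs : 1 / 8 < s.re) :
    ‖zt n s‖ ≤ ‖s‖ * ‖s - 1‖ * (n + 1 : ℝ) ^ (-(9/8) : ℝ) := by
  refine (zt_bound n (by linarith)).trans ?_
  gcongr
  · linarith [n.cast_nonneg (α := ℝ)]
  · linarith

lemma zt_hasSum {s : ℂ} (hs : 1 < s.re) : ∑' n, zt n s = riemannZeta₁ s - 1 := by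
  have hs1 : s ≠ 1 := by rintro rfl; simp at hs
  have h1 : HasSum (fun n : ℕ => ((n + 1 : ℝ) : ℂ) ^ (-s)) (riemannZeta s) := by
    rw [zeta_eq_tsum_one_div_nat_add_one_cpow hs]
    have := (Complex.summable_one_div_nat_cpow (p := s)).mpr hs
    have := (summable_nat_add_iff 1).mpr this
    have h := this.hasSum
    push_cast at h ⊢
    simpa [cpow_neg] using h
  have h2 : HasSum (fun n : ℕ => ((n + 2 : ℝ) : ℂ) ^ (1 - s) - ((n + 1 : ℝ) : ℂ) ^ (1 - s)) (-1) := by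
    have hsum : Summable (fun n : ℕ => ((n + 2 : ℝ) : ℂ) ^ (1 - s) - ((n + 1 : ℝ) : ℂ) ^ (1 - s)) := by
      have ha : Summable (fun n => zt n s) := by
        refine Summable.of_norm_bounded (zt_summable_aux.mul_left (‖s‖ * ‖s - 1‖)) ?_
        intro n; exact zt_bound' n (by linarith)
      have := ha.sub (h1.summable.mul_left (s - 1))
      refine this.congr (fun n => ?_)
      rw [zt]; ring
    rw [hsum.hasSum_iff_tendsto_nat]
    have e : ∀ N : ℕ, ∑ n ∈ Finset.range N, (((n + 2 : ℝ) : ℂ) ^ (1 - s) - ((n + 1 : ℝ) : ℂ) ^ (1 - s))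
        = ((N + 1 : ℝ) : ℂ) ^ (1 - s) - 1 := by
      intro N
      have := Finset.sum_range_sub (fun n : ℕ => ((n + 1 : ℝ) : ℂ) ^ (1 - s)) N
      simp only [Nat.cast_add, Nat.cast_one, Nat.cast_zero, zero_add, ofReal_one, one_cpow] at this
      rw [← this]
      refine Finset.sum_congr rfl (fun n _ => ?_)
      congr 3; push_cast; ring
    simp_rw [e]
    have hz : Tendsto (fun N : ℕ => ((N + 1 : ℝ) : ℂ) ^ (1 - s)) atTop (𝓝 0) := by
      rw [tendsto_zero_iff_norm_tendsto_zero]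
      have : ∀ N : ℕ, ‖((N + 1 : ℝ) : ℂ) ^ (1 - s)‖ = ((N + 1 : ℝ)) ^ (-(s.re - 1)) := by
        intro N
        rw [norm_cpow_eq_rpow_re_of_pos (by positivity)]
        simp
      simp_rw [this]
      exact (tendsto_rpow_neg_atTop (by linarith)).comp
        (tendsto_atTop_add_const_right _ _ tendsto_natCast_atTop_atTop)
    simpa using hz.sub_const 1
  have h3 := (h1.mul_left (s - 1)).add h2
  have h4 : (s - 1) * riemannZeta s = riemannZeta₁ s := by
    rw [riemannZeta_eq_inv_sub_mul hs1]
    field_simp [sub_ne_zero.mpr hs1]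
  rw [h4] at h3
  rw [← sub_eq_add_neg] at h3
  rw [← h3.tsum_eq]
  refine tsum_congr (fun n => ?_)
  rw [zt]; ring

lemma zt_tsum {s : ℂ} (hs : 1 / 8 < s.re) : ∑' n, zt n s = riemannZeta₁ s - 1 := by
  set R : ℝ := ‖s‖ + 3 with hR
  set U : Set ℂ := {w | 1/8 < w.re} ∩ Metric.ball 0 R with hU
  have hUo : IsOpen U := (isOpen_lt continuous_const continuous_re).inter Metric.isOpen_ball
  have hUc : IsPreconnected U := ((convex_halfSpace_re_gt _).inter (convex_ball _ _)).isPreconnected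
  have hd : DifferentiableOn ℂ (fun w => ∑' n, zt n w) U := by
    refine differentiableOn_tsum_of_summable_norm (zt_summable_aux.mul_left (R * (R + 1))) ?_ hUo ?_
    · intro n
      have h1 : ((n + 1 : ℝ) : ℂ) ≠ 0 := by exact_mod_cast (by positivity : (0:ℝ) < n + 1).ne'
      have h2 : ((n + 2 : ℝ) : ℂ) ≠ 0 := by exact_mod_cast (by positivity : (0:ℝ) < n + 2).ne'
      unfold zt
      refine DifferentiableOn.sub (DifferentiableOn.add (DifferentiableOn.mul (by fun_prop) ?_) ?_) ?_
      · exact DifferentiableOn.const_cpow (by fun_prop) (Or.inl h1)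
      · exact DifferentiableOn.const_cpow (by fun_prop) (Or.inl h2)
      · exact DifferentiableOn.const_cpow (by fun_prop) (Or.inl h1)
    · intro n w hw
      refine (zt_bound' n hw.1).trans ?_
      have h1 : ‖w‖ ≤ R := by have h := hw.2; simp at h; exact h.le
      have h2 : ‖w - 1‖ ≤ R + 1 := (norm_sub_le _ _).trans (by simpa using h1)
      gcongr
  have hd2 : DifferentiableOn ℂ (fun w => riemannZeta₁ w - 1) U :=
    (differentiable_riemannZeta₁.sub_const 1).differentiableOn
  have h2 : (2 : ℂ) ∈ U := by
    refine ⟨by norm_num, ?_⟩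
    simp; linarith [norm_nonneg s]
  have := AnalyticOnNhd.eqOn_of_preconnected_of_eventuallyEq (hd.analyticOnNhd hUo)
    (hd2.analyticOnNhd hUo) hUc h2 (by
      have : {w : ℂ | 1 < w.re} ∈ 𝓝 (2 : ℂ) :=
        (isOpen_lt continuous_const continuous_re).mem_nhds (by simp)
      filter_upwards [this] with w hw
      exact zt_hasSum hw)
  exact this (x := s) ⟨hs, by simp [hR]⟩

/-- polynomial growth of `(s-1)ζ(s)` -/
lemma Z_growth : ∃ C : ℝ, 0 < C ∧ ∀ s : ℂ, 1 / 8 < s.re → ‖riemannZeta₁ s‖ ≤ C * (1 + ‖s‖) ^ 2 := by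
  set K := ∑' n : ℕ, (n + 1 : ℝ) ^ (-(9/8) : ℝ) with hK
  have hK0 : 0 ≤ K := tsum_nonneg (fun n => by positivity)
  refine ⟨1 + K, by positivity, fun s hs => ?_⟩
  have h1 : ‖∑' n, zt n s‖ ≤ ‖s‖ * ‖s - 1‖ * K := by
    rw [hK, ← tsum_mul_left]
    exact tsum_of_norm_bounded (zt_summable_aux.mul_left _).hasSum (fun n => zt_bound' n hs)
  rw [zt_tsum hs] at h1
  have h2 : ‖riemannZeta₁ s‖ ≤ ‖riemannZeta₁ s - 1‖ + 1 := by
    simpa using norm_add_le (riemannZeta₁ s - 1) 1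
  have h3 : ‖s - 1‖ ≤ ‖s‖ + 1 := (norm_sub_le _ _).trans (by simp)
  have h4 : ‖s‖ * ‖s - 1‖ * K ≤ ‖s‖ * (‖s‖ + 1) * K := by gcongr
  have := norm_nonneg s
  nlinarith [mul_nonneg hK0 this]

/-- `ζ` is close to `1` for `Re w ≥ 2`. -/
lemma zeta_near_one {w : ℂ} (hw : 2 ≤ w.re) : ‖riemannZeta w - 1‖ ≤ 3 / 4 := by
  rw [zeta_eq_tsum_one_div_nat_add_one_cpow (by linarith)]
  have hs : Summable fun n : ℕ => 1 / ((n : ℂ) + 1) ^ w := by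
    have := (Complex.summable_one_div_nat_cpow (p := w)).mpr (by linarith)
    simpa using (summable_nat_add_iff 1).mpr this
  rw [hs.tsum_eq_zero_add]
  simp only [Nat.cast_zero, zero_add, one_cpow, ne_eq, one_ne_zero, not_false_eq_true, div_self,
    add_sub_cancel_left]
  have h2 : HasSum (fun n : ℕ => 1 / ((n + 2 : ℕ) : ℝ) ^ 2) (Real.pi ^ 2 / 6 - 1) := by
    have := (hasSum_nat_add_iff' 2).mpr hasSum_zeta_two
    simpa [Finset.sum_range_succ] using this
  refine (tsum_of_norm_bounded h2 (fun n => ?_)).trans ?_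
  · have : ((n + 1 : ℕ) : ℂ) + 1 = ((n + 2 : ℕ) : ℝ) := by push_cast; ring
    rw [this, norm_div, norm_one, norm_cpow_eq_rpow_re_of_pos (by positivity)]
    gcongr
    rw [← Real.rpow_natCast]
    apply Real.rpow_le_rpow_of_exponent_le
    · push_cast; linarith [n.cast_nonneg (α := ℝ)]
    · simpa using hw
  · have := Real.pi_lt_d2
    nlinarith [Real.pi_pos]

end ZRH

namespace ZRH
open MeasureTheory Filter Topology Set

/-- Weierstrass factor minus one -/
noncomputable def wf (k : ℕ) (z : ℂ) : ℂ := (1 + z / (k + 1)) * exp (-(z / (k + 1))) - 1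

lemma wf_bound {R : ℝ} (k : ℕ) (hk : R ≤ k) {z : ℂ} (hz : ‖z‖ ≤ R) :
    ‖wf k z‖ ≤ 3 * R ^ 2 * (1 / ((k + 1 : ℕ) : ℝ) ^ 2) := by
  set x := z / (k + 1) with hx
  have hR0 : 0 ≤ R := (norm_nonneg z).trans hz
  have hkn : ‖(k + 1 : ℂ)‖ = k + 1 := by
    have : (k + 1 : ℂ) = ((k + 1 : ℝ) : ℂ) := by push_cast; ring
    rw [this, Complex.norm_real, Real.norm_of_nonneg (by positivity)]
  have hxn : ‖x‖ ≤ R / (k + 1) := by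
    rw [hx, norm_div, hkn]; gcongr
  have hx1 : ‖x‖ ≤ 1 := hxn.trans (by rw [div_le_one (by positivity)]; linarith)
  have h1 := Complex.norm_exp_sub_one_sub_id_le (x := -x) (by simpa using hx1)
  have e : wf k z = (1 + x) * (exp (-x) - 1 - (-x)) - x ^ 2 := by
    rw [wf, ← hx]; ring
  rw [e]
  have h2 : ‖1 + x‖ ≤ 2 := (norm_add_le _ _).trans (by simp; linarith)
  have h3 : ‖(1 + x) * (exp (-x) - 1 - (-x)) - x ^ 2‖ ≤ 2 * ‖x‖ ^ 2 + ‖x‖ ^ 2 := by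
    refine (norm_sub_le _ _).trans ?_
    rw [norm_mul, norm_pow]
    rw [norm_neg] at h1
    gcongr
  have h4 : ‖x‖ ^ 2 ≤ (R / (k + 1)) ^ 2 := by gcongr
  have h5 : 3 * R ^ 2 * (1 / ((k + 1 : ℕ) : ℝ) ^ 2) = 3 * (R / (k + 1)) ^ 2 := by
    push_cast; field_simp
  rw [h5]; linarith

lemma ne_of_re {z : ℂ} (hz : -1 < z.re) (k : ℕ) : z + (k + 1) ≠ 0 := by
  intro h
  have := congrArg re h
  simp at this
  have := k.cast_nonneg (α := ℝ)
  linarith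

lemma wf_ne {z : ℂ} (hz : -1 < z.re) (k : ℕ) : 1 + wf k z ≠ 0 := by
  have hk : (k + 1 : ℂ) ≠ 0 := by exact_mod_cast k.succ_ne_zero
  have := ne_of_re hz k
  rw [wf, add_sub_cancel]
  refine mul_ne_zero ?_ (exp_ne_zero _)
  have e : 1 + z / (k + 1) = (z + (k + 1)) / (k + 1) := by field_simp; ring
  rw [e]; exact div_ne_zero this hk

lemma wf_diff (k : ℕ) : Differentiable ℂ (fun z => 1 + wf k z) := by
  unfold wf; fun_prop

lemma wf_mult (R : ℝ) : MultipliableLocallyUniformlyOn (fun k z => 1 + wf k z) (Metric.ball (0:ℂ) R) := by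
  refine Summable.multipliableLocallyUniformlyOn_nat_one_add Metric.isOpen_ball
    (u := fun k => 3 * R ^ 2 * (1 / ((k + 1 : ℕ) : ℝ) ^ 2)) ?_ ?_ ?_
  · exact ((summable_nat_add_iff 1).mpr hasSum_zeta_two.summable).mul_left _
  · filter_upwards [eventually_ge_atTop ⌈R⌉₊] with k hk z hz
    refine wf_bound k ?_ ?_
    · exact Nat.ceil_le.mp hk
    · simpa using (Metric.mem_ball.mp hz).le
  · intro k
    have := (wf_diff k).continuous
    have h2 : wf k = fun z => (1 + wf k z) - 1 := by funext z; ring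
    rw [h2]; exact (this.sub continuous_const).continuousOn

lemma wf_prod (n : ℕ) (z : ℂ) (hz : z ≠ 0) (hz' : -1 < z.re) (hn : n ≠ 0) :
    z * GammaSeq z n * ∏ k ∈ Finset.range n, (1 + wf k z) =
      exp (-z * ((harmonic n : ℝ) - Real.log n : ℝ)) := by
  have e1 : ∏ k ∈ Finset.range n, (1 + wf k z) =
      (∏ k ∈ Finset.range n, (z + (k + 1))) / n.factorial * exp (- z * (harmonic n : ℝ)) := by
    clear hn
    induction n with
    | zero => simp
    | succ n ih =>
      rw [Finset.prod_range_succ, ih, Finset.prod_range_succ, harmonic_succ, Nat.factorial_succ]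
      have hk : (n + 1 : ℂ) ≠ 0 := by exact_mod_cast n.succ_ne_zero
      have hf : (n.factorial : ℂ) ≠ 0 := by exact_mod_cast n.factorial_ne_zero
      have : exp (-z * ((harmonic n + ((n + 1 : ℕ) : ℚ)⁻¹ : ℚ) : ℝ)) =
          exp (-z * (harmonic n : ℝ)) * exp (-(z / (n + 1))) := by
        rw [← Complex.exp_add]; congr 1; push_cast; field_simp; ring
      rw [this, wf]
      push_cast
      field_simp
      ring
  have e2 : ∏ j ∈ Finset.range (n + 1), (z + j) = z * ∏ k ∈ Finset.range n, (z + (k + 1)) := by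
    rw [Finset.prod_range_succ']; push_cast; rw [mul_comm]; simp
  have hP : ∏ k ∈ Finset.range n, (z + (k + 1)) ≠ 0 := by
    rw [Finset.prod_ne_zero_iff]; intro k _; exact ne_of_re hz' k
  have hf : (n.factorial : ℂ) ≠ 0 := by exact_mod_cast n.factorial_ne_zero
  have hn0 : (n : ℂ) ≠ 0 := by exact_mod_cast hn
  rw [e1, GammaSeq, e2, cpow_def_of_ne_zero hn0]
  have : exp (-z * ((harmonic n : ℝ) - Real.log n : ℝ)) = exp (Complex.log n * z) * exp (-z * (harmonic n : ℝ)) := by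
    rw [← Complex.exp_add]; congr 1
    have : Complex.log n = (Real.log n : ℝ) := by
      rw [← Complex.natCast_log]
    rw [this]; push_cast; ring
  rw [this]
  field_simp

lemma wf_tprod (z : ℂ) (hz' : -1 < z.re) :
    Gamma (z + 1) * ∏' k, (1 + wf k z) = exp (-z * Real.eulerMascheroniConstant) := by
  by_cases hz : z = 0
  · subst hz; simp [wf]
  have hm : Multipliable fun k => 1 + wf k z :=
    (wf_mult (‖z‖ + 1)).multipliable (by simp)
  have h1 := hm.hasProd.tendsto_prod_nat
  have h2 := ((GammaSeq_tendsto_Gamma z).const_mul z).mul h1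
  rw [Gamma_add_one z hz]
  have h3 : Tendsto (fun n : ℕ => exp (-z * ((harmonic n : ℝ) - Real.log n : ℝ))) atTop
      (𝓝 (exp (-z * Real.eulerMascheroniConstant))) := by
    have := Real.tendsto_harmonic_sub_log
    have h4 := (Complex.continuous_ofReal.tendsto _).comp this
    exact (Complex.continuous_exp.tendsto _).comp (h4.const_mul (-z))
  refine tendsto_nhds_unique h2 (h3.congr' ?_)
  filter_upwards [eventually_ne_atTop 0] with n hn
  exact (wf_prod n z hz hz' hn).symm

lemma wf_logDeriv (k : ℕ) {z : ℂ} (hz : -1 < z.re) :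
    logDeriv (fun z => 1 + wf k z) z = 1 / (z + (k + 1)) - 1 / (k + 1) := by
  have hk : (k + 1 : ℂ) ≠ 0 := by exact_mod_cast k.succ_ne_zero
  have h0 := ne_of_re hz k
  have hd : HasDerivAt (fun z => 1 + wf k z)
      ((1 / (k + 1)) * exp (-(z / (k + 1))) + (1 + z / (k + 1)) * (exp (-(z / (k + 1))) * (-(1 / (k + 1))))) z := by
    have e : (fun z => 1 + wf k z) = fun z => (1 + z / (k + 1)) * exp (-(z / (k + 1))) := by
      funext z; rw [wf]; ring
    rw [e]
    have h1 : HasDerivAt (fun z : ℂ => 1 + z / (k + 1)) (1 / (k + 1)) z :=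
      ((hasDerivAt_id z).div_const _).const_add 1
    have h2 : HasDerivAt (fun z : ℂ => -(z / (k + 1))) (-(1 / (k + 1))) z :=
      ((hasDerivAt_id z).div_const _).neg
    exact h1.mul h2.cexp
  rw [logDeriv_apply, hd.deriv, wf]
  have hE := exp_ne_zero (-(z / (k + 1)))
  have : 1 + ((1 + z / (k + 1)) * exp (-(z / (k + 1))) - 1) = (z + (k + 1)) / (k + 1) * exp (-(z / (k + 1))) := by
    field_simp; ring
  rw [this]
  generalize exp (-(z / (k + 1))) = e at *
  field_simp
  ring

lemma gk_norm_le {w : ℂ} (hw : 0 ≤ w.re) {m : ℝ} (hm : 0 < m) :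
    ‖1 / (m : ℂ) - 1 / (w + m)‖ ≤ √‖w‖ * m ^ (-(3/2) : ℝ) := by
  have hne : w + m ≠ 0 := by
    intro h; have := congrArg re h; simp at this; linarith
  have hm' : (m : ℂ) ≠ 0 := by exact_mod_cast hm.ne'
  have e : 1 / (m : ℂ) - 1 / (w + m) = w / (m * (w + m)) := by field_simp; ring
  have h1 : ‖w‖ ≤ ‖w + m‖ := by
    rw [← sq_le_sq₀ (norm_nonneg _) (norm_nonneg _), Complex.sq_norm, Complex.sq_norm,
        normSq_apply, normSq_apply]
    simp; nlinarith
  have h2 : m ≤ ‖w + m‖ := by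
    refine le_trans ?_ (re_le_norm _); simp; exact hw
  have h3 : √‖w‖ * √m ≤ ‖w + m‖ := by
    rw [← Real.sqrt_mul (norm_nonneg _)]
    rw [Real.sqrt_le_left (norm_nonneg _)]
    have := norm_nonneg w
    nlinarith
  rw [e, norm_div, norm_mul, Complex.norm_real, Real.norm_of_nonneg hm.le,
    div_le_iff₀ (by positivity)]
  have h4 : m ^ (-(3/2) : ℝ) * m * √m = 1 := by
    rw [Real.sqrt_eq_rpow]
    nth_rewrite 2 [← Real.rpow_one m]
    rw [← Real.rpow_add hm, ← Real.rpow_add hm]; norm_num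
  have h5 : √‖w‖ * √‖w‖ = ‖w‖ := Real.mul_self_sqrt (norm_nonneg _)
  calc ‖w‖ = √‖w‖ * √‖w‖ * (m ^ (-(3/2) : ℝ) * m * √m) := by rw [h4, h5, mul_one]
    _ = √‖w‖ * m ^ (-(3/2) : ℝ) * m * (√‖w‖ * √m) := by ring
    _ ≤ √‖w‖ * m ^ (-(3/2) : ℝ) * m * ‖w + m‖ := by gcongr
    _ = _ := by ring

lemma digamma_hasSum {z : ℂ} (hz0 : 0 ≤ z.re) :
    HasSum (fun k : ℕ => 1 / (k + 1 : ℂ) - 1 / (z + (k + 1)))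
      (digamma (z + 1) + Real.eulerMascheroniConstant) := by
  have hz : -1 < z.re := by linarith
  set s : Set ℂ := {z | -1 < z.re} ∩ Metric.ball 0 (‖z‖ + 1) with hs
  have hso : IsOpen s := (isOpen_lt continuous_const continuous_re).inter Metric.isOpen_ball
  have hzs : z ∈ s := ⟨hz, by simp⟩
  have hΓ : ∀ w : ℂ, -1 < w.re → Gamma (w + 1) ≠ 0 := by
    intro w hw; apply Gamma_ne_zero_of_re_pos; simp; linarith
  have hP : ∀ w : ℂ, -1 < w.re → ∏' k, (1 + wf k w) = exp (-w * Real.eulerMascheroniConstant) / Gamma (w + 1) := by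
    intro w hw; rw [← wf_tprod w hw]; field_simp [hΓ w hw]
  have hnez : ∏' k, (1 + wf k z) ≠ 0 := by
    rw [hP z hz]; exact div_ne_zero (exp_ne_zero _) (hΓ z hz)
  have hsum : Summable (fun k : ℕ => 1 / (k + 1 : ℂ) - 1 / (z + (k + 1))) := by
    refine Summable.of_norm_bounded (g := fun k : ℕ => √‖z‖ * ((k + 1 : ℕ) : ℝ) ^ (-(3/2) : ℝ))
      ?_ (fun k => ?_)
    · exact ((summable_nat_add_iff 1).mpr ((Real.summable_nat_rpow (p := -(3/2))).mpr
        (by norm_num))).mul_left _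
    · have := gk_norm_le hz0 (m := ((k + 1 : ℕ) : ℝ)) (by positivity)
      push_cast at this ⊢
      exact this
  have hsum' : Summable fun k => logDeriv (fun z => 1 + wf k z) z := by
    refine hsum.neg.congr (fun k => ?_)
    rw [wf_logDeriv k hz]; ring
  have h := logDeriv_tprod_eq_tsum hso hzs (f := fun k z => 1 + wf k z) (fun k => wf_ne hz k)
    (fun k => (wf_diff k).differentiableOn) hsum' ((wf_mult _).mono inter_subset_right) hnez
  have h2 : logDeriv (fun w => ∏' k, (1 + wf k w)) z =
      -Real.eulerMascheroniConstant - digamma (z + 1) := by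
    have e : (fun w => ∏' k, (1 + wf k w)) =ᶠ[𝓝 z]
        fun w => exp (-w * Real.eulerMascheroniConstant) / Gamma (w + 1) := by
      filter_upwards [hso.mem_nhds hzs] with w hw
      exact hP w hw.1
    have hΓd : DifferentiableAt ℂ Gamma (z + 1) := by
      refine differentiableAt_Gamma _ (fun m h => ?_)
      have := congrArg re h
      simp at this
      have := m.cast_nonneg (α := ℝ)
      linarith
    rw [(logDeriv_congr_nhds e).eq_of_nhds, logDeriv_div (f := fun w => exp (-w * Real.eulerMascheroniConstant))
      (g := fun w => Gamma (w + 1)) z (exp_ne_zero _) (hΓ z hz) (by fun_prop)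
      (DifferentiableAt.comp (f := fun z : ℂ => z + 1) z hΓd (by fun_prop))]
    congr 1
    · rw [logDeriv_apply]
      have : HasDerivAt (fun w : ℂ => exp (-w * Real.eulerMascheroniConstant))
        (exp (-z * Real.eulerMascheroniConstant) * (-1 * Real.eulerMascheroniConstant)) z :=
        ((hasDerivAt_id z).neg.mul_const _).cexp
      rw [this.deriv, mul_div_cancel_left₀ _ (exp_ne_zero _)]; ring
    · rw [digamma_def, logDeriv_apply, logDeriv_apply, deriv_comp_add_const]
  have h3 : ∑' k : ℕ, (1 / (k + 1 : ℂ) - 1 / (z + (k + 1))) = digamma (z + 1) + Real.eulerMascheroniConstant := by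
    have : ∀ k : ℕ, 1 / (k + 1 : ℂ) - 1 / (z + (k + 1)) = - logDeriv (fun z => 1 + wf k z) z := by
      intro k; rw [wf_logDeriv k hz]; ring
    rw [tsum_congr this, tsum_neg, ← h, h2]; ring
  rw [← h3]; exact hsum.hasSum


/-- terms of the partial fraction expansion -/
noncomputable def gk (k : ℕ) (w : ℂ) : ℂ := 1 / ((2 * (k + 1) : ℝ) : ℂ) - 1 / (w + (2 * (k + 1) : ℝ))

/-- the constant `g0 0` -/
noncomputable def gc : ℝ := - Real.log Real.pi / 2 - Real.eulerMascheroniConstant / 2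

/-- log-derivative of the Gamma factor -/
noncomputable def g0 (w : ℂ) : ℂ := digamma (w / 2 + 1) / 2 - (Real.log Real.pi / 2 : ℝ)

/-- tail bound -/
noncomputable def gη (N : ℕ) : ℝ := ∑' k : ℕ, (2 * ((k + N : ℕ) + 1) : ℝ) ^ (-(3/2) : ℝ)

lemma g0_hasSum {w : ℂ} (hw : 0 ≤ w.re) : HasSum (fun k => gk k w) (g0 w - gc) := by
  have h := (digamma_hasSum (z := w / 2) (by simp; linarith)).div_const 2
  have e : g0 w - gc = (digamma (w / 2 + 1) + Real.eulerMascheroniConstant) / 2 := by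
    rw [g0, gc]; push_cast; ring
  rw [e]
  refine h.congr_fun (fun k => ?_)
  have hk : (k + 1 : ℂ) ≠ 0 := by exact_mod_cast k.succ_ne_zero
  have h0 := ne_of_re (z := w / 2) (by simp; linarith) k
  have h1 : w + 2 * (k + 1) ≠ 0 := by
    intro h; apply h0; linear_combination h / 2
  rw [gk]; push_cast
  field_simp

lemma gη_summable : Summable fun k : ℕ => (2 * ((k : ℕ) + 1) : ℝ) ^ (-(3/2) : ℝ) := by
  have h := ((summable_nat_add_iff 1).mpr ((Real.summable_nat_rpow (p := -(3/2))).mpr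
        (by norm_num))).mul_left ((2 : ℝ) ^ (-(3/2) : ℝ))
  refine h.congr (fun k => ?_)
  rw [← Real.mul_rpow (by norm_num) (by positivity)]
  push_cast; ring_nf

lemma gη_tendsto : Tendsto gη atTop (𝓝 0) := by
  have := tendsto_sum_nat_add (fun k : ℕ => (2 * ((k : ℕ) + 1) : ℝ) ^ (-(3/2) : ℝ))
  exact this

lemma g0_tail {w : ℂ} (hw : 0 ≤ w.re) (N : ℕ) :
    ‖g0 w - gc - ∑ k ∈ Finset.range N, gk k w‖ ≤ gη N * √(1 + ‖w‖) := by
  have h := (hasSum_nat_add_iff' N).mpr (g0_hasSum hw)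
  rw [← h.tsum_eq]
  have hs := ((summable_nat_add_iff N).mpr gη_summable).mul_left √(1 + ‖w‖)
  have := tsum_of_norm_bounded (f := fun k => gk (k + N) w) hs.hasSum (fun k => by
    refine (gk_norm_le hw (m := 2 * ((k + N : ℕ) + 1)) (by positivity)).trans ?_
    gcongr
    linarith)
  rw [tsum_mul_left] at this
  rw [mul_comm]; exact this

lemma gη_nonneg (N : ℕ) : 0 ≤ gη N := tsum_nonneg (fun k => by positivity)

lemma g0_growth {w : ℂ} (hw : 0 ≤ w.re) : ‖g0 w‖ ≤ (gη 0 + |gc|) * √(1 + ‖w‖) := by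
  have h := g0_tail hw 0
  simp only [Finset.range_zero, Finset.sum_empty, sub_zero] at h
  have h1 : 1 ≤ √(1 + ‖w‖) := by rw [Real.one_le_sqrt]; linarith [norm_nonneg w]
  have h2 : ‖g0 w‖ ≤ ‖g0 w - gc‖ + |gc| := by
    have := norm_add_le (g0 w - gc) gc
    simpa using this
  nlinarith [abs_nonneg gc]

lemma g0_diff {w : ℂ} (hw : -2 < w.re) : DifferentiableAt ℂ g0 w := by
  unfold g0
  have h1 : ∀ m : ℕ, w / 2 + 1 ≠ -m := by
    intro m h
    have := congrArg re h
    simp at this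
    have := m.cast_nonneg (α := ℝ)
    linarith
  have h2 : DifferentiableAt ℂ digamma (w / 2 + 1) := by
    have ha : AnalyticAt ℂ Gamma (w / 2 + 1) := by
      rw [Complex.analyticAt_iff_eventually_differentiableAt]
      have : {z : ℂ | 0 < z.re} ∈ 𝓝 (w / 2 + 1) :=
        (isOpen_lt continuous_const continuous_re).mem_nhds (by simp; linarith)
      filter_upwards [this] with z hz
      refine differentiableAt_Gamma _ (fun m h => ?_)
      rw [h] at hz
      simp at hz
      have := m.cast_nonneg (α := ℝ)
      linarith
    exact (ha.deriv.div ha (Gamma_ne_zero h1)).differentiableAt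
  have h3 : DifferentiableAt ℂ (fun w => digamma (w / 2 + 1)) w :=
    DifferentiableAt.comp (f := fun w : ℂ => w / 2 + 1) w h2 (by fun_prop)
  fun_prop

lemma g0_zero : g0 0 = gc := by
  rw [g0, gc]; simp [digamma_one]; ring

lemma g0_one : g0 1 = ((1 - Real.log 2 - Real.eulerMascheroniConstant / 2 - Real.log Real.pi / 2 : ℝ) : ℂ) := by
  have h1 : ∀ m : ℕ, (1 / 2 : ℂ) ≠ -m := by
    intro m h
    have := congrArg re h
    simp at this
    have := m.cast_nonneg (α := ℝ)
    linarith
  rw [g0, digamma_apply_add_one _ h1, digamma_one_half]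
  have : Complex.log 2 = (Real.log 2 : ℝ) := by
    rw [Complex.ofReal_log (by norm_num)]; simp
  rw [this]; push_cast; ring

end ZRH

namespace ZRH
open MeasureTheory Filter Topology Set

lemma logDeriv_bound {F : ℂ → ℂ} {c w : ℂ} {r R M : ℝ} (hF : Differentiable ℂ F) (hr0 : 0 ≤ r)
    (hrR : r < R) (hM : 0 < M) (hne : ∀ s ∈ Metric.ball c R, F s ≠ 0)
    (hb : ∀ s ∈ Metric.ball c R, ‖F s‖ ≤ Real.exp M * ‖F c‖) (hw : ‖w - c‖ ≤ r) :
    ‖logDeriv F w‖ ≤ 8 * R / (R - r) ^ 2 * M := by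
  have hR : 0 < R := by linarith
  have hcm : c ∈ Metric.ball c R := Metric.mem_ball_self hR
  have hd : DifferentiableOn ℂ (logDeriv F) (Metric.ball c R) := by
    have h1 : Differentiable ℂ (deriv F) := by
      have := (hF.contDiff (n := 2)).differentiable_deriv_two
      exact this
    exact h1.differentiableOn.div hF.differentiableOn hne
  obtain ⟨g, hg0, hg⟩ := (hd.isExactOn_ball).with_val_at c 0
  have hgd : DifferentiableOn ℂ g (Metric.ball c R) := fun z hz =>
    (hg z hz).differentiableAt.differentiableWithinAt
  have hconst : ∀ s ∈ Metric.ball c R, F s * exp (-g s) = F c := by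
    intro s hs
    have := Metric.isOpen_ball.is_const_of_deriv_eq_zero (s := Metric.ball c R)
      (f := fun s => F s * exp (-g s)) (convex_ball c R).isPreconnected
      (hF.differentiableOn.mul hgd.neg.cexp) (fun z hz => by
        have h1 := (hF z).hasDerivAt.mul (hg z hz).neg.cexp
        have h2 := h1.deriv
        rw [Pi.zero_apply]
        refine Eq.trans h2 ?_
        rw [logDeriv_apply]
        have := hne z hz
        field_simp; ring) hs hcm
    simpa [hg0] using this
  have hre : ∀ s ∈ Metric.ball c R, (g s).re ≤ M := by
    intro s hs
    have h1 : F s = F c * exp (g s) := by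
      rw [← hconst s hs, mul_assoc, ← Complex.exp_add]; simp
    have h2 := hb s hs
    rw [h1, norm_mul, mul_comm, Complex.norm_exp] at h2
    have h3 : 0 < ‖F c‖ := norm_pos_iff.mpr (hne c hcm)
    exact Real.exp_le_exp.mp (le_of_mul_le_mul_right h2 h3)
  set δ := (R - r) / 2 with hδ
  have hδ0 : 0 < δ := by rw [hδ]; linarith
  have hgb : ∀ s, ‖s - c‖ ≤ r + δ → ‖g s‖ ≤ 2 * M * R / δ := by
    intro s hs
    have h1 := borelCaratheodory_zero (f := fun z => g (c + z)) (z := s - c) hM (R := R) ?_ ?_ hR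
      (by simp; linarith) (by simpa using hg0)
    · simp only [add_sub_cancel] at h1
      refine h1.trans ?_
      have : δ ≤ R - ‖s - c‖ := by linarith
      gcongr
      linarith
    · intro z hz
      refine DifferentiableWithinAt.comp (t := Metric.ball c R) (f := fun z => c + z) z
        (hgd _ (by simpa using hz)) (by fun_prop) (fun y hy => by simpa using hy)
    · intro z hz
      exact hre _ (by simpa using hz)
  have hwm : w ∈ Metric.ball c R := by rw [Metric.mem_ball, dist_eq_norm]; linarith
  have hsub : Metric.closedBall w δ ⊆ Metric.ball c R := by
    intro s hs
    rw [Metric.mem_ball, dist_eq_norm]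
    rw [Metric.mem_closedBall, dist_eq_norm] at hs
    have := norm_add_le (s - w) (w - c)
    simp only [sub_add_sub_cancel] at this
    linarith
  have hfin := norm_deriv_le_of_forall_mem_sphere_norm_le (f := g) (c := w) hδ0
    (C := 2 * M * R / δ) ((hgd.mono hsub).diffContOnCl_ball (U := Metric.closedBall w δ) le_rfl)
    (fun s hs => by
      apply hgb
      rw [Metric.mem_sphere, dist_eq_norm] at hs
      have := norm_add_le (s - w) (w - c)
      simp only [sub_add_sub_cancel] at this
      linarith)
  rw [(hg w hwm).deriv] at hfin
  refine hfin.trans (le_of_eq ?_)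
  rw [hδ]
  have : R - r ≠ 0 := by linarith
  field_simp; norm_num

lemma Z_eq {s : ℂ} (hs : s ≠ 1) : riemannZeta₁ s = (s - 1) * riemannZeta s := by
  rw [riemannZeta_eq_inv_sub_mul hs]; field_simp [sub_ne_zero.mpr hs]

lemma Z_ne (RH : RiemannHypothesis) {s : ℂ} (hs : 1 / 2 < s.re) : riemannZeta₁ s ≠ 0 := by
  by_cases h1 : s = 1
  · rw [h1, riemannZeta₁_one]; exact one_ne_zero
  rw [Z_eq h1]
  refine mul_ne_zero (sub_ne_zero.mpr h1) (fun h => ?_)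
  have := RH s h (by
    rintro ⟨n, rfl⟩
    simp at hs
    have := n.cast_nonneg (α := ℝ)
    linarith) h1
  linarith

/-- log derivative of `(s-1)ζ(s)` -/
noncomputable def zz (s : ℂ) : ℂ := logDeriv riemannZeta₁ s

lemma zz_eq {s : ℂ} (hs : s ≠ 1) (h0 : riemannZeta s ≠ 0) :
    zz s = deriv riemannZeta s / riemannZeta s + 1 / (s - 1) := by
  have e : riemannZeta₁ =ᶠ[𝓝 s] fun s => (s - 1) * riemannZeta s := by
    filter_upwards [isOpen_ne.mem_nhds hs] with w hw
    exact Z_eq hw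
  rw [zz, (logDeriv_congr_nhds e).eq_of_nhds, logDeriv_mul (f := fun s => s - 1) (g := riemannZeta) s
    (sub_ne_zero.mpr hs) h0 (by fun_prop)
    (differentiableAt_riemannZeta hs)]
  rw [logDeriv_apply, logDeriv_apply]
  simp [deriv_sub_const]
  ring

lemma zz_one : zz 1 = Real.eulerMascheroniConstant := by
  rw [zz, logDeriv_apply, riemannZeta₁_one, deriv_riemannZeta₁_one, div_one]

lemma zz_diff (RH : RiemannHypothesis) {s : ℂ} (hs : 1 / 2 < s.re) : DifferentiableAt ℂ zz s := by
  have h1 : DifferentiableAt ℂ (deriv riemannZeta₁) s :=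
    (differentiable_riemannZeta₁.contDiff (n := 2)).differentiable_deriv_two s
  exact h1.div (differentiable_riemannZeta₁ s) (Z_ne RH hs)

lemma zeta_ne_two {w : ℂ} (hw : 2 ≤ w.re) : 1 / 4 ≤ ‖riemannZeta w‖ := by
  have h := zeta_near_one hw
  have := norm_sub_norm_le (1 : ℂ) (1 - riemannZeta w)
  rw [norm_one, sub_sub_cancel, norm_sub_rev] at this
  linarith

lemma log_le_sqrt {K y : ℝ} (hK : 1 ≤ K) (hy : 1 ≤ y) : Real.log (K * y ^ 2) ≤ (Real.log K + 4) * √y := by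
  have hs : 0 < √y := Real.sqrt_pos.mpr (by linarith)
  have h1 : 1 ≤ √y := by rw [Real.one_le_sqrt]; exact hy
  rw [Real.log_mul (by positivity) (by positivity), Real.log_pow]
  have h2 : Real.log y = 2 * Real.log √y := by rw [Real.log_sqrt (by linarith)]; ring
  have h3 := Real.log_le_sub_one_of_pos hs
  have h4 := Real.log_nonneg hK
  rw [h2]; push_cast
  nlinarith

lemma zz_growth_two : ∃ C : ℝ, 0 ≤ C ∧ ∀ w : ℂ, 2 ≤ w.re → ‖zz w‖ ≤ C := by
  set f : ℕ → ℂ := fun n => (ArithmeticFunction.vonMangoldt n : ℂ) with hf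
  have hs2 : LSeriesSummable f 2 :=
    ArithmeticFunction.LSeriesSummable_vonMangoldt (by norm_num)
  refine ⟨(∑' n, ‖LSeries.term f 2 n‖) + 1, by positivity, fun w hw => ?_⟩
  have hw1 : w ≠ 1 := by rintro rfl; norm_num at hw
  have h0 : riemannZeta w ≠ 0 := by
    have := zeta_ne_two hw
    intro h; rw [h] at this; norm_num at this
  rw [zz_eq hw1 h0]
  have h1 : ‖deriv riemannZeta w / riemannZeta w‖ ≤ ∑' n, ‖LSeries.term f 2 n‖ := by
    have h := ArithmeticFunction.LSeries_vonMangoldt_eq_deriv_riemannZeta_div (s := w) (by linarith)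
    have : ‖deriv riemannZeta w / riemannZeta w‖ = ‖LSeries f w‖ := by
      rw [hf, h, neg_div, norm_neg]
    rw [this, LSeries]
    refine tsum_of_norm_bounded hs2.norm.hasSum (fun n => ?_)
    exact LSeries.norm_term_le_of_re_le_re f (by simpa using hw) n
  have h2 : ‖1 / (w - 1)‖ ≤ 1 := by
    rw [norm_div, norm_one]
    have : 1 ≤ ‖w - 1‖ := by
      refine le_trans ?_ (re_le_norm _); simp; linarith
    rw [div_le_one (by linarith)]; exact this
  exact (norm_add_le _ _).trans (add_le_add h1 h2)

lemma zz_growth (RH : RiemannHypothesis) {a : ℝ} (ha : 1 / 2 < a) :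
    ∃ C : ℝ, 0 ≤ C ∧ ∀ w : ℂ, a ≤ w.re → ‖zz w‖ ≤ C * √(1 + ‖w‖) := by
  obtain ⟨C2, hC2, h2⟩ := zz_growth_two
  obtain ⟨K, hK0, hK⟩ := Z_growth
  have hone : ∀ w : ℂ, 1 ≤ √(1 + ‖w‖) := fun w => by
    rw [Real.one_le_sqrt]; linarith [norm_nonneg w]
  by_cases ha2 : 2 ≤ a
  · refine ⟨C2, hC2, fun w hw => (h2 w (ha2.trans hw)).trans ?_⟩
    have := hone w
    nlinarith
  push Not at ha2
  set K' : ℝ := 1 + 4 * K * 16 with hK'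
  have hK'1 : 1 ≤ K' := by rw [hK']; linarith
  set A := 8 * (3/2) / (3/2 - (2 - a)) ^ 2 with hA
  have hA0 : 0 ≤ A := by positivity
  have hL := Real.log_nonneg hK'1
  refine ⟨C2 + A * (Real.log K' + 5) * 2, by positivity, fun w hw => ?_⟩
  by_cases hw2 : 2 ≤ w.re
  · have := h2 w hw2
    have := hone w
    have : 0 ≤ A * (Real.log K' + 5) * 2 := by positivity
    nlinarith
  push Not at hw2
  set c : ℂ := ⟨2, w.im⟩ with hc
  have hcre : c.re = 2 := rfl
  have hc1 : c ≠ 1 := by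
    intro h; have := congrArg re h; rw [hcre] at this; norm_num at this
  have hwc : ‖w - c‖ ≤ 2 - a := by
    have : w - c = ((w.re - 2 : ℝ) : ℂ) := by
      apply Complex.ext <;> simp [hc]
    rw [this, Complex.norm_real, Real.norm_eq_abs, abs_of_nonpos (by linarith)]; linarith
  have hZc : 1 / 4 ≤ ‖riemannZeta₁ c‖ := by
    rw [Z_eq hc1, norm_mul]
    have h1 : 1 ≤ ‖c - 1‖ := by
      refine le_trans ?_ (re_le_norm _); simp [hcre]; norm_num
    have := zeta_ne_two (w := c) (by rw [hcre])
    nlinarith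
  set y := 1 + ‖c‖ with hy
  have hy1 : 1 ≤ y := by rw [hy]; linarith [norm_nonneg c]
  set M := Real.log (K' * y ^ 2) + 1 with hM
  have hM0 : 0 < M := by
    have : 0 ≤ Real.log (K' * y ^ 2) := Real.log_nonneg (by nlinarith)
    linarith
  have hbd := logDeriv_bound (F := riemannZeta₁) (c := c) (w := w) (r := 2 - a) (R := 3/2) (M := M)
    differentiable_riemannZeta₁ (by linarith) (by linarith) hM0 ?_ ?_ hwc
  · rw [← hA] at hbd
    refine hbd.trans ?_
    have h3 := log_le_sqrt hK'1 hy1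
    have h4 : √y ≤ 2 * √(1 + ‖w‖) := by
      rw [show 2 * √(1 + ‖w‖) = √(4 * (1 + ‖w‖)) by
          rw [Real.sqrt_mul (by norm_num), show (4:ℝ) = 2^2 by norm_num, Real.sqrt_sq (by norm_num)]]
      apply Real.sqrt_le_sqrt
      have : ‖c‖ ≤ ‖w‖ + ‖w - c‖ := by
        have := norm_sub_le w (w - c)
        simpa using this
      linarith [norm_nonneg w]
    have h5 : 1 ≤ √y := by rw [Real.one_le_sqrt]; exact hy1
    have h6 : M ≤ (Real.log K' + 5) * √y := by rw [hM]; linarith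
    have h7 : M ≤ (Real.log K' + 5) * (2 * √(1 + ‖w‖)) := h6.trans (by gcongr)
    have h8 := mul_le_mul_of_nonneg_left h7 hA0
    have := hone w
    nlinarith
  · intro s hs
    apply Z_ne RH
    rw [Metric.mem_ball, dist_eq_norm] at hs
    have := (abs_re_le_norm (s - c)).trans_lt hs
    rw [abs_lt] at this
    simp [hcre] at this
    linarith [this.1]
  · intro s hs
    rw [Metric.mem_ball, dist_eq_norm] at hs
    have h3 := (abs_re_le_norm (s - c)).trans_lt hs
    rw [abs_lt] at h3
    simp [hcre] at h3
    have h4 := hK s (by linarith [h3.1])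
    have h5 : ‖s‖ ≤ ‖c‖ + 3 / 2 := by
      have := norm_add_le (s - c) c
      simp at this; linarith
    have h6 : (1 + ‖s‖) ^ 2 ≤ 16 * y ^ 2 := by
      have : 1 + ‖s‖ ≤ 4 * y := by rw [hy]; linarith [norm_nonneg c]
      calc (1 + ‖s‖) ^ 2 ≤ (4 * y) ^ 2 := by gcongr
        _ = _ := by ring
    have h7 : Real.exp M ≥ K' * y ^ 2 := by
      rw [hM]
      have : Real.exp (Real.log (K' * y ^ 2)) = K' * y ^ 2 := Real.exp_log (by positivity)
      refine le_trans this.ge (Real.exp_le_exp.mpr (by linarith))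
    calc ‖riemannZeta₁ s‖ ≤ K * (16 * y ^ 2) := h4.trans (by gcongr)
      _ ≤ K' * y ^ 2 * (1 / 4) := by rw [hK']; nlinarith [sq_nonneg y]
      _ ≤ _ := by gcongr

end ZRH

namespace ZRH
open MeasureTheory Filter Topology Set

/-- the Riemann xi function (on the right half plane) -/
noncomputable def xi (s : ℂ) : ℂ :=
  riemannZeta₁ s * exp (-((Real.log Real.pi / 2 : ℝ) * s)) * Gamma (s / 2 + 1)

/-- log-derivative of xi -/
noncomputable def ff (s : ℂ) : ℂ := zz s + g0 s

lemma gam_hasDeriv {s : ℂ} (hs : -2 < s.re) :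
    HasDerivAt (fun s => Gamma (s / 2 + 1)) ((g0 s + (Real.log Real.pi / 2 : ℝ)) * Gamma (s / 2 + 1)) s := by
  have h1 : ∀ m : ℕ, s / 2 + 1 ≠ -m := by
    intro m h
    have := congrArg re h
    simp at this
    have := m.cast_nonneg (α := ℝ)
    linarith
  have h2 := (differentiableAt_Gamma _ h1).hasDerivAt
  have h3 : HasDerivAt (fun s : ℂ => s / 2 + 1) (1 / 2) s := ((hasDerivAt_id s).div_const 2).add_const 1
  have h4 := h2.comp s h3
  refine h4.congr_deriv ?_
  have := Gamma_ne_zero h1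
  rw [g0, digamma_def, logDeriv_apply]
  generalize deriv Gamma (s / 2 + 1) = d
  generalize Gamma (s / 2 + 1) = g at this ⊢
  field_simp
  ring

lemma xi_hasDeriv {s : ℂ} (hs : -2 < s.re) (hZ : riemannZeta₁ s ≠ 0) :
    HasDerivAt xi (ff s * xi s) s := by
  have h1 := (differentiable_riemannZeta₁ s).hasDerivAt
  have h2 : HasDerivAt (fun s : ℂ => exp (-((Real.log Real.pi / 2 : ℝ) * s)))
      (exp (-((Real.log Real.pi / 2 : ℝ) * s)) * (-((Real.log Real.pi / 2 : ℝ) * 1))) s :=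
    ((hasDerivAt_id s).const_mul _).neg.cexp
  have h3 := (h1.mul h2).mul (gam_hasDeriv hs)
  refine h3.congr_deriv ?_
  simp only [Pi.mul_apply]
  rw [ff, xi, zz, logDeriv_apply]
  field_simp
  ring

lemma xi_diff {s : ℂ} (hs : -2 < s.re) : DifferentiableAt ℂ xi s := by
  have h1 := (differentiable_riemannZeta₁ s)
  exact (h1.mul (by fun_prop)).mul (gam_hasDeriv hs).differentiableAt

lemma xi_ne (RH : RiemannHypothesis) {s : ℂ} (hs : 1 / 2 < s.re) : xi s ≠ 0 := by
  refine mul_ne_zero (mul_ne_zero (Z_ne RH hs) (exp_ne_zero _)) (Gamma_ne_zero_of_re_pos ?_)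
  simp; linarith

lemma gron {F m : ℂ → ℂ} {p w : ℂ} {K : ℝ}
    (hF : ∀ x ∈ Icc (0:ℝ) 1, HasDerivAt F (m (p + x * (w - p)) * F (p + x * (w - p))) (p + x * (w - p)))
    (hm : ∀ x ∈ Icc (0:ℝ) 1, ‖m (p + x * (w - p))‖ ≤ K) :
    ‖F w‖ ≤ ‖F p‖ * Real.exp (K * ‖w - p‖) := by
  have hd : ∀ x ∈ Icc (0:ℝ) 1, HasDerivAt (fun x : ℝ => F (p + x * (w - p)))
      (m (p + x * (w - p)) * F (p + x * (w - p)) * (w - p)) x := by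
    intro x hx
    have h1 : HasDerivAt (fun x : ℝ => p + (x : ℂ) * (w - p)) (w - p) x := by
      have := ((Complex.ofRealCLM.hasDerivAt (x := x)).mul_const (w - p)).const_add p
      simpa using this
    exact (hF x hx).comp_of_eq x h1 rfl
  have := norm_le_gronwallBound_of_norm_deriv_right_le (f := fun x : ℝ => F (p + x * (w - p)))
    (f' := fun x : ℝ => m (p + x * (w - p)) * F (p + x * (w - p)) * (w - p))
    (δ := ‖F p‖) (K := K * ‖w - p‖) (ε := 0) (a := 0) (b := 1)
    (fun x hx => (hd x hx).continuousAt.continuousWithinAt)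
    (fun x hx => (hd x ⟨hx.1, hx.2.le⟩).hasDerivWithinAt) (by simp)
    (fun x hx => by
      rw [norm_mul, norm_mul, add_zero]
      have := hm x ⟨hx.1, hx.2.le⟩
      calc _ ≤ K * ‖F (p + x * (w - p))‖ * ‖w - p‖ := by gcongr
        _ = _ := by ring) 1 ⟨zero_le_one, le_rfl⟩
  rw [gronwallBound_ε0] at this
  simpa using this

lemma gam_upper : ∃ B : ℝ, 0 ≤ B ∧ ∀ w : ℂ, 0 ≤ w.re →
    ‖Gamma (w / 2 + 1)‖ ≤ Real.exp (B * ((1 + ‖w‖) * √(1 + ‖w‖))) := by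
  set B := gη 0 + |gc| + |Real.log Real.pi / 2| with hB
  have hB0 : 0 ≤ B := by have := gη_nonneg 0; positivity
  refine ⟨B, hB0, fun w hw => ?_⟩
  have h := gron (F := fun w => Gamma (w / 2 + 1)) (m := fun w => g0 w + (Real.log Real.pi / 2 : ℝ))
    (p := 0) (w := w) (K := B * √(1 + ‖w‖)) (fun x hx => by
      refine gam_hasDeriv ?_
      have := mul_nonneg hx.1 hw
      simp; linarith) (fun x hx => by
      simp only [zero_add, sub_zero]
      refine (norm_add_le _ _).trans ?_
      have h1 : ‖g0 (x * w)‖ ≤ (gη 0 + |gc|) * √(1 + ‖w‖) := by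
        refine (g0_growth (w := x * w) (by simpa using mul_nonneg hx.1 hw)).trans ?_
        have := gη_nonneg 0
        gcongr
        rw [norm_mul, Complex.norm_real, Real.norm_of_nonneg hx.1]
        nlinarith [norm_nonneg w, hx.2]
      rw [Complex.norm_real, Real.norm_eq_abs]
      have h2 : 1 ≤ √(1 + ‖w‖) := by rw [Real.one_le_sqrt]; linarith [norm_nonneg w]
      rw [hB]
      nlinarith [abs_nonneg (Real.log Real.pi / 2)])
  refine h.trans ?_
  simp only [sub_zero, zero_div, zero_add, Gamma_one, norm_one, one_mul]
  apply Real.exp_le_exp.mpr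
  have : 0 ≤ B * √(1 + ‖w‖) := by positivity
  nlinarith

lemma xi_upper : ∃ A B : ℝ, 0 ≤ A ∧ 0 ≤ B ∧ ∀ w : ℂ, 1 / 8 < w.re →
    ‖xi w‖ ≤ A * Real.exp (B * ((1 + ‖w‖) * √(1 + ‖w‖))) := by
  obtain ⟨B, hB, h⟩ := gam_upper
  obtain ⟨C, hC, hZ⟩ := Z_growth
  refine ⟨C, B + 2, hC.le, by positivity, fun w hw => ?_⟩
  rw [xi, norm_mul, norm_mul]
  have h1 := h w (by linarith)
  have h2 := hZ w hw
  have h3 : ‖exp (-((Real.log Real.pi / 2 : ℝ) * w))‖ ≤ 1 := by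
    rw [Complex.norm_exp, Real.exp_le_one_iff]
    have : 0 ≤ Real.log Real.pi / 2 := by
      have := Real.log_nonneg (x := Real.pi) (by linarith [Real.pi_gt_three]); linarith
    rw [neg_re, re_ofReal_mul]
    nlinarith
  set y := 1 + ‖w‖ with hy
  have hy1 : 1 ≤ y := by rw [hy]; linarith [norm_nonneg w]
  have hs1 : 1 ≤ √y := by rw [Real.one_le_sqrt]; exact hy1
  have h4 : y ^ 2 ≤ Real.exp (2 * (y * √y)) := by
    have h5 : y ≤ Real.exp y := by linarith [Real.add_one_le_exp y]
    calc y ^ 2 ≤ (Real.exp y) ^ 2 := by gcongr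
      _ = Real.exp (2 * y) := by rw [← Real.exp_nat_mul]; norm_num
      _ ≤ _ := by apply Real.exp_le_exp.mpr; nlinarith
  calc _ ≤ C * y ^ 2 * 1 * Real.exp (B * (y * √y)) := by gcongr
    _ ≤ C * Real.exp (2 * (y * √y)) * 1 * Real.exp (B * (y * √y)) := by gcongr
    _ = _ := by rw [mul_one, mul_assoc, ← Real.exp_add]; ring_nf

lemma ff_growth (RH : RiemannHypothesis) {a : ℝ} (ha : 1 / 2 < a) :
    ∃ C : ℝ, 0 ≤ C ∧ ∀ w : ℂ, a ≤ w.re → ‖ff w‖ ≤ C * √(1 + ‖w‖) := by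
  obtain ⟨C, hC, h⟩ := zz_growth RH ha
  have := gη_nonneg 0
  refine ⟨C + (gη 0 + |gc|), by positivity, fun w hw => ?_⟩
  rw [ff, add_mul]
  exact (norm_add_le _ _).trans (add_le_add (h w hw) (g0_growth (by linarith)))

lemma xi_lower (RH : RiemannHypothesis) {a : ℝ} (ha : 1 / 2 < a) (ha1 : a < 1) :
    ∃ A B : ℝ, 0 ≤ A ∧ 0 ≤ B ∧ ∀ w : ℂ, a ≤ w.re →
    ‖(xi w)⁻¹‖ ≤ A * Real.exp (B * ((1 + ‖w‖) * √(1 + ‖w‖))) := by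
  obtain ⟨C, hC, h⟩ := ff_growth RH ha
  refine ⟨‖(xi a)⁻¹‖, C * 2, norm_nonneg _, by positivity, fun w hw => ?_⟩
  have hre : ∀ x ∈ Icc (0:ℝ) 1, a ≤ ((a : ℂ) + x * (w - a)).re := by
    intro x hx
    have : 0 ≤ x * (w.re - a) := mul_nonneg hx.1 (by linarith)
    simp; linarith
  have hna : ‖w - a‖ ≤ 1 + ‖w‖ := by
    refine (norm_sub_le _ _).trans ?_
    rw [Complex.norm_real, Real.norm_of_nonneg (by linarith)]; linarith
  have hg := gron (F := fun w => (xi w)⁻¹) (m := fun w => - ff w) (p := a) (w := w)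
    (K := C * (2 * √(1 + ‖w‖))) (fun x hx => by
      have h1 := hre x hx
      have h2 := xi_hasDeriv (s := (a : ℂ) + x * (w - a)) (by linarith) (Z_ne RH (by linarith))
      have h3 := h2.inv (xi_ne RH (by linarith))
      refine h3.congr_deriv ?_
      have := xi_ne RH (s := (a : ℂ) + x * (w - a)) (by linarith)
      field_simp) (fun x hx => by
      rw [norm_neg]
      refine (h _ (hre x hx)).trans ?_
      gcongr
      rw [show 2 * √(1 + ‖w‖) = √(4 * (1 + ‖w‖)) by
          rw [Real.sqrt_mul (by norm_num), show (4:ℝ) = 2^2 by norm_num, Real.sqrt_sq (by norm_num)]]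
      apply Real.sqrt_le_sqrt
      have h3 : ‖(a : ℂ) + x * (w - a)‖ ≤ a + ‖w - a‖ := by
        refine (norm_add_le _ _).trans ?_
        rw [norm_mul, Complex.norm_real, Complex.norm_real, Real.norm_of_nonneg hx.1,
          Real.norm_of_nonneg (by linarith)]
        nlinarith [norm_nonneg (w - a), hx.2]
      linarith [norm_nonneg w])
  refine hg.trans ?_
  refine mul_le_mul_of_nonneg_left (Real.exp_le_exp.mpr ?_) (norm_nonneg _)
  have : 0 ≤ C * (2 * √(1 + ‖w‖)) := by positivity
  nlinarith

lemma xi_completed {s : ℂ} (h0 : 0 < s.re) (h1 : s.re < 1) :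
    xi s = s * (s - 1) / 2 * completedRiemannZeta s := by
  have hs0 : s ≠ 0 := by rintro rfl; simp at h0
  have hs1 : s ≠ 1 := by rintro rfl; simp at h1
  have hG : Gammaℝ s ≠ 0 := Gammaℝ_ne_zero_of_re_pos h0
  have hpi : (Real.pi : ℂ) ^ (-s / 2) = exp (-((Real.log Real.pi / 2 : ℝ) * s)) := by
    rw [cpow_def_of_ne_zero (by exact_mod_cast Real.pi_ne_zero), ← Complex.ofReal_log Real.pi_pos.le]
    congr 1; push_cast; ring
  have h3 : completedRiemannZeta s = riemannZeta s * Gammaℝ s := by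
    rw [riemannZeta_def_of_ne_zero hs0]; field_simp
  rw [xi, Z_eq hs1, h3, Gammaℝ_def, hpi, Gamma_add_one _ (div_ne_zero hs0 two_ne_zero)]
  ring

lemma xi_one_sub {s : ℂ} (h0 : 0 < s.re) (h1 : s.re < 1) : xi (1 - s) = xi s := by
  rw [xi_completed h0 h1, xi_completed (s := 1 - s) (by simp; linarith) (by simp; linarith),
    completedRiemannZeta_one_sub]
  ring

lemma xi_conj {s : ℂ} (h1 : s.re < 1) :
    ‖xi (starRingEnd ℂ s)‖ = ‖xi s‖ := by
  have hs1 : s ≠ 1 := by rintro rfl; simp at h1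
  have hs2 : starRingEnd ℂ s ≠ 1 := by
    intro h; have := congrArg re h; simp at this; linarith
  have : xi (starRingEnd ℂ s) = starRingEnd ℂ (xi s) := by
    have h2 : starRingEnd ℂ 2 = 2 := by apply Complex.ext <;> simp
    rw [xi, xi, Z_eq hs1, Z_eq hs2, riemannZeta_conj, map_mul, map_mul, map_mul, ← Gamma_conj, ← exp_conj]
    simp [h2]
  rw [this, norm_conj]

lemma xi_reflect {s : ℂ} (h0 : 0 < s.re) (h1 : s.re < 1) :
    ‖xi ⟨1 - s.re, s.im⟩‖ = ‖xi s‖ := by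
  rw [← xi_one_sub h0 h1, ← xi_conj (s := 1 - s) (by simp; linarith)]
  congr 2
  apply Complex.ext <;> simp


lemma q_shift {z c : ℂ} (hz : 1 ≤ ‖z‖) (hc : ‖c‖ ≤ 1) :
    (1 + ‖z + c‖) * √(1 + ‖z + c‖) ≤ 6 * ‖z‖ ^ (3 / 2 : ℝ) := by
  have h1 : 1 + ‖z + c‖ ≤ 3 * ‖z‖ := by linarith [norm_add_le z c]
  have h2 : √(1 + ‖z + c‖) ≤ 2 * √‖z‖ := by
    rw [show 2 * √‖z‖ = √(4 * ‖z‖) by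
          rw [Real.sqrt_mul (by norm_num), show (4:ℝ) = 2^2 by norm_num, Real.sqrt_sq (by norm_num)]]
    apply Real.sqrt_le_sqrt; linarith
  have h3 : ‖z‖ ^ (3 / 2 : ℝ) = ‖z‖ * √‖z‖ := by
    rw [Real.sqrt_eq_rpow]
    nth_rewrite 2 [← Real.rpow_one ‖z‖]
    rw [← Real.rpow_add (by linarith)]; norm_num
  rw [h3]
  calc _ ≤ (3 * ‖z‖) * (2 * √‖z‖) := by gcongr
    _ = _ := by ring

lemma xi_real_ratio {a x : ℝ} (ha : 1 / 2 < a) (ha1 : a < 1) (hx : 4 ≤ x) :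
    ‖xi (x + (1 - a : ℝ)) / xi (x + a)‖ ≤ 7 * Real.pi := by
  have e : ∀ y : ℝ, 4 ≤ y → ‖xi y‖ = (y - 1) * ‖riemannZeta y‖ * Real.exp (-(Real.log Real.pi / 2 * y))
      * Real.Gamma (y / 2 + 1) := by
    intro y hy
    have hy1 : (y : ℂ) ≠ 1 := by
      intro h; have := congrArg re h; simp at this; linarith
    rw [xi, Z_eq hy1, norm_mul, norm_mul, norm_mul, Complex.norm_exp]
    congr 1
    · congr 1
      · congr 1
        rw [show (y : ℂ) - 1 = ((y - 1 : ℝ) : ℂ) by push_cast; ring, Complex.norm_real,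
          Real.norm_of_nonneg (by linarith)]
      · rw [neg_re, re_ofReal_mul, ofReal_re]
    · rw [show (y : ℂ) / 2 + 1 = ((y / 2 + 1 : ℝ) : ℂ) by push_cast; ring, Complex.Gamma_ofReal,
        Complex.norm_real, Real.norm_of_nonneg (Real.Gamma_pos_of_pos (by linarith)).le]
  have h1 : ∀ y : ℝ, 4 ≤ y → 1 / 4 ≤ ‖riemannZeta y‖ ∧ ‖riemannZeta y‖ ≤ 7 / 4 := by
    intro y hy
    refine ⟨zeta_ne_two (by simp; linarith), ?_⟩
    have := zeta_near_one (w := y) (by simp; linarith)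
    have h2 := norm_add_le (riemannZeta y - 1) 1
    simp only [sub_add_cancel, norm_one] at h2
    linarith
  rw [← ofReal_add, ← ofReal_add, norm_div, e _ (by linarith), e _ (by linarith)]
  have hG : Real.Gamma ((x + (1 - a)) / 2 + 1) ≤ Real.Gamma ((x + a) / 2 + 1) := by
    refine Real.Gamma_strictMonoOn_Ici.monotoneOn ?_ ?_ ?_
    · rw [mem_Ici]; linarith
    · rw [mem_Ici]; linarith
    · linarith
  have hG0 : 0 < Real.Gamma ((x + a) / 2 + 1) := Real.Gamma_pos_of_pos (by linarith)
  have hL : 0 ≤ Real.log Real.pi := Real.log_nonneg (by linarith [Real.pi_gt_three])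
  have hE : Real.exp (-(Real.log Real.pi / 2 * (x + (1 - a)))) ≤
      Real.pi * Real.exp (-(Real.log Real.pi / 2 * (x + a))) := by
    nth_rewrite 2 [← Real.exp_log Real.pi_pos]
    rw [← Real.exp_add]
    apply Real.exp_le_exp.mpr
    nlinarith
  obtain ⟨_, hz1⟩ := h1 (x + (1 - a)) (by linarith)
  obtain ⟨hz2, _⟩ := h1 (x + a) (by linarith)
  have hz3 : ‖riemannZeta (x + (1 - a) : ℝ)‖ ≤ 7 * ‖riemannZeta (x + a : ℝ)‖ := by linarith
  have hx1 : 0 < x + a - 1 := by linarith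
  have hx2 : x + (1 - a) - 1 ≤ x + a - 1 := by linarith
  have hE0 := Real.exp_pos (-(Real.log Real.pi / 2 * (x + a)))
  have hz0 : 0 < ‖riemannZeta (x + a : ℝ)‖ := by linarith
  rw [div_le_iff₀ (by positivity)]
  have hx0 : 0 ≤ x + (1 - a) - 1 := by linarith
  have hGG : 0 ≤ Real.Gamma ((x + (1 - a)) / 2 + 1) := (Real.Gamma_pos_of_pos (by linarith)).le
  calc _ ≤ (x + a - 1) * (7 * ‖riemannZeta (x + a : ℝ)‖) *
        (Real.pi * Real.exp (-(Real.log Real.pi / 2 * (x + a)))) * Real.Gamma ((x + a) / 2 + 1) := by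
        gcongr
    _ = _ := by ring

lemma xi_dom (RH : RiemannHypothesis) {a : ℝ} (ha : 1 / 2 < a) (ha1 : a ≤ 3 / 4) {z : ℂ}
    (hz : 0 ≤ z.re) : ‖xi (z + (1 - a : ℝ))‖ ≤ ‖xi (z + a)‖ := by
  obtain ⟨A1, B1, hA1, hB1, hu⟩ := xi_upper
  obtain ⟨A2, B2, hA2, hB2, hl⟩ := xi_lower RH ha (by linarith)
  have key : ‖xi (z + (1 - a : ℝ)) / xi (z + a)‖ ≤ 1 := by
    refine PhragmenLindelof.right_half_plane_of_bounded_on_real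
      (f := fun z => xi (z + (1 - a : ℝ)) / xi (z + a)) ?_ ⟨3 / 2, by norm_num, (B1 + B2) * 6, ?_⟩ ?_ ?_ hz
    · apply DifferentiableOn.diffContOnCl
      intro w hw
      have hw0 : 0 ≤ w.re := closure_lt_subset_le continuous_const continuous_re hw
      apply DifferentiableAt.differentiableWithinAt
      have d1 : DifferentiableAt ℂ (fun z : ℂ => xi (z + (1 - a : ℝ))) w :=
        DifferentiableAt.comp (g := xi) (f := fun z : ℂ => z + (1 - a : ℝ)) w (xi_diff (by simp; linarith))
          (by fun_prop)
      have d2 : DifferentiableAt ℂ (fun z : ℂ => xi (z + a)) w :=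
        DifferentiableAt.comp (g := xi) (f := fun z : ℂ => z + a) w (xi_diff (by simp; linarith))
          (by fun_prop)
      exact d1.div d2 (xi_ne RH (by simp; linarith))
    · refine Asymptotics.IsBigO.of_bound (A1 * A2) ?_
      have h1 : ∀ᶠ w : ℂ in Bornology.cobounded ℂ ⊓ 𝓟 {z | 0 < z.re}, 0 < w.re :=
        mem_inf_of_right (mem_principal_self _)
      have h2 : ∀ᶠ w : ℂ in Bornology.cobounded ℂ ⊓ 𝓟 {z | 0 < z.re}, 1 ≤ ‖w‖ :=
        mem_inf_of_left (tendsto_norm_cobounded_atTop.eventually (eventually_ge_atTop 1))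
      filter_upwards [h1, h2] with w hw1 hw2
      rw [div_eq_mul_inv, norm_mul, Real.norm_of_nonneg (Real.exp_pos _).le]
      have e1 := hu (w + (1 - a : ℝ)) (by simp; linarith)
      have e2 := hl (w + a) (by simp; linarith)
      have q1 := q_shift (z := w) (c := (1 - a : ℝ)) hw2 (by
        rw [Complex.norm_real, Real.norm_of_nonneg (by linarith)]; linarith)
      have q2 := q_shift (z := w) (c := a) hw2 (by
        rw [Complex.norm_real, Real.norm_of_nonneg (by linarith)]; linarith)
      calc _ ≤ (A1 * Real.exp (B1 * (6 * ‖w‖ ^ (3 / 2 : ℝ)))) * (A2 * Real.exp (B2 * (6 * ‖w‖ ^ (3 / 2 : ℝ)))) := by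
            refine mul_le_mul (e1.trans ?_) (e2.trans ?_) (norm_nonneg _) (by positivity)
            · refine mul_le_mul_of_nonneg_left (Real.exp_le_exp.mpr ?_) hA1
              exact mul_le_mul_of_nonneg_left q1 hB1
            · refine mul_le_mul_of_nonneg_left (Real.exp_le_exp.mpr ?_) hA2
              exact mul_le_mul_of_nonneg_left q2 hB2
        _ = A1 * A2 * (Real.exp (B1 * (6 * ‖w‖ ^ (3 / 2 : ℝ))) * Real.exp (B2 * (6 * ‖w‖ ^ (3 / 2 : ℝ)))) := by ring
        _ = _ := by rw [← Real.exp_add]; ring_nf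
    · refine ⟨7 * Real.pi, ?_⟩
      rw [eventually_map]
      filter_upwards [eventually_ge_atTop 4] with x hx
      exact xi_real_ratio ha (by linarith) hx
    · intro y
      have h0 := xi_ne RH (s := y * I + a) (by simp; linarith)
      have hr := xi_reflect (s := y * I + a) (by simp; linarith) (by simp; linarith)
      have e : (⟨1 - (y * I + a : ℂ).re, (y * I + a : ℂ).im⟩ : ℂ) = y * I + (1 - a : ℝ) := by
        apply Complex.ext <;> simp
      rw [e] at hr
      rw [norm_div, hr, div_self (norm_ne_zero_iff.mpr h0)]
  have h0 := xi_ne RH (s := z + a) (by simp; linarith)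
  rwa [norm_div, div_le_one (norm_pos_iff.mpr h0)] at key

lemma ff_pos (RH : RiemannHypothesis) {a : ℝ} (ha : 1 / 2 < a) (ha1 : a ≤ 3 / 4) (y : ℝ) :
    0 ≤ (ff (a + y * I)).re := by
  set s : ℂ := a + y * I with hs
  have hsre : s.re = a := by simp [hs]
  have hne := xi_ne RH (s := s) (by rw [hsre]; exact ha)
  -- derivative of normSq along the horizontal line
  have hd := xi_hasDeriv (s := s) (by rw [hsre]; linarith) (Z_ne RH (by rw [hsre]; exact ha))
  have hline : HasDerivAt (fun h : ℝ => xi (s + h)) (ff s * xi s) 0 := by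
    have h1 : HasDerivAt (fun h : ℝ => s + (h : ℂ)) 1 0 := by
      have := (Complex.ofRealCLM.hasDerivAt (x := (0:ℝ))).const_add s
      simpa using this
    have := hd.comp_of_eq (0:ℝ) h1 (by simp)
    rw [mul_one] at this
    exact this
  have hn : HasDerivAt (fun h : ℝ => ‖xi (s + h)‖ ^ 2) (2 * ((ff s).re * ‖xi s‖ ^ 2)) 0 := by
    have := hline.norm_sq
    refine this.congr_deriv ?_
    simp only [ofReal_zero, add_zero]
    rw [Complex.inner, Complex.sq_norm, Complex.normSq_apply]
    simp only [map_mul, mul_re, conj_re, conj_im, mul_im]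
    ring
  have hneg : HasDerivAt (fun h : ℝ => ‖xi (s + (-h : ℝ))‖ ^ 2) (-(2 * ((ff s).re * ‖xi s‖ ^ 2))) 0 := by
    have h1 : HasDerivAt (fun h : ℝ => -h) (-1) 0 := (hasDerivAt_id (0:ℝ)).neg
    have := HasDerivAt.comp_of_eq (h₂ := fun h : ℝ => ‖xi (s + h)‖ ^ 2) (0:ℝ) hn h1 (by simp)
    refine this.congr_deriv (by ring)
  have hdiff := hn.sub hneg
  have hmono : ∀ᶠ h in 𝓝[>] (0:ℝ), 0 ≤ slope (fun h : ℝ => ‖xi (s + h)‖ ^ 2 - ‖xi (s + (-h : ℝ))‖ ^ 2) 0 h := by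
    have hpos : ∀ᶠ h in 𝓝[>] (0:ℝ), 0 < h := self_mem_nhdsWithin
    have hsm : ∀ᶠ h in 𝓝[>] (0:ℝ), h < 1 / 8 :=
      nhdsWithin_le_nhds (Iio_mem_nhds (by norm_num))
    filter_upwards [hpos, hsm] with h h1 h2
    rw [slope_def_field]
    simp only [ofReal_zero, add_zero, neg_zero, sub_self, sub_zero]
    refine div_nonneg ?_ h1.le
    rw [sub_nonneg]
    have h3 := xi_dom RH ha ha1 (z := h + y * I) (by simp; exact h1.le)
    have h4 := xi_reflect (s := s + (-h : ℝ)) (by simp [hsre]; linarith) (by simp [hsre]; linarith)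
    have e : (⟨1 - (s + (-h : ℝ)).re, (s + (-h : ℝ)).im⟩ : ℂ) = (h + y * I : ℂ) + (1 - a : ℝ) := by
      apply Complex.ext <;> simp [hs] <;> ring
    have e2 : (h + y * I : ℂ) + a = s + h := by rw [hs]; ring
    rw [e] at h4
    rw [e2] at h3
    rw [← h4]
    gcongr
  have hlim := hasDerivAt_iff_tendsto_slope.mp hdiff
  have hsub : Ioi (0:ℝ) ⊆ {0}ᶜ := fun x hx => ne_of_gt hx
  have hlim2 := hlim.mono_left (nhdsWithin_mono (0:ℝ) hsub)
  have := ge_of_tendsto hlim2 hmono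
  have hp : 0 < ‖xi s‖ ^ 2 := by
    have := norm_pos_iff.mpr hne; positivity
  by_contra hcon
  push Not at hcon
  nlinarith

end ZRH

namespace ZRH
open MeasureTheory Filter Topology Set

lemma sqrt_shift (c z : ℂ) : √(1 + ‖c + z‖) ≤ √(1 + ‖c‖) * √(1 + ‖z‖) := by
  rw [← Real.sqrt_mul (by positivity)]
  apply Real.sqrt_le_sqrt
  nlinarith [norm_add_le c z, norm_nonneg c, norm_nonneg z, mul_nonneg (norm_nonneg c) (norm_nonneg z)]

/-- the error constant -/
noncomputable def MM (b : ℝ) (c : ℂ) : ℝ := ∫ x : ℝ, √(1 + ‖c + x * I‖) / (b ^ 2 + x ^ 2)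

lemma MM_integrable {b : ℝ} (hb : 0 < b) (c : ℂ) :
    Integrable (fun x : ℝ => √(1 + ‖c + x * I‖) / (b ^ 2 + x ^ 2)) := by
  have h := line_integrable (b := b) (C := √(1 + ‖c‖)) hb
    (φ := fun x : ℝ => ((√(1 + ‖c + x * I‖) : ℝ) : ℂ)) (by fun_prop) (fun x => by
      rw [Complex.norm_real, Real.norm_of_nonneg (Real.sqrt_nonneg _)]
      have := sqrt_shift c (x * I)
      simpa using this)
  have := h.re
  refine this.congr (ae_of_all _ fun x => ?_)
  simp only [← ofReal_div, RCLike.re_to_complex, ofReal_re]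

lemma lemB {f FR FL : ℂ → ℂ} {L b t η C1 C2 C3 : ℝ} {c : ℂ} (hL : 0 < L) (hb : 0 < b)
    (hc : c = (1 - b : ℝ) + t * I) (hη : 0 ≤ η)
    (hfd : ∀ w : ℂ, 1 - b ≤ w.re → DifferentiableAt ℂ f w)
    (hfg : ∀ w : ℂ, 1 - b ≤ w.re → ‖f w‖ ≤ C1 * √(1 + ‖w‖))
    (hpos : ∀ y : ℝ, 0 ≤ (f ((1 - b : ℝ) + y * I)).re)
    (hRd : ∀ w : ℂ, 1 - b ≤ w.re → DifferentiableAt ℂ FR w)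
    (hRg : ∀ w : ℂ, 1 - b ≤ w.re → ‖FR w‖ ≤ C2 * √(1 + ‖w‖))
    (hLd : ∀ w : ℂ, w.re ≤ 1 - b → DifferentiableAt ℂ FL w)
    (hLg : ∀ w : ℂ, w.re ≤ 1 - b → ‖FL w‖ ≤ C3 * √(1 + ‖w‖))
    (hrem : ∀ w : ℂ, w.re = 1 - b → ‖f w * exp (w * L) - FR w - FL w‖ ≤ η * √(1 + ‖w‖)) :
    ‖exp (-(c * L)) * (FR (c + b) + FL (c - b)) + exp (-(b * L)) * (starRingEnd ℂ) (f (c + b))‖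
      ≤ 2 * (f (c + b)).re + η * ((b / Real.pi) * Real.exp (-((1 - b) * L)) * MM b c) := by
  have hcre : c.re = 1 - b := by simp [hc]
  have growthpos : ∀ {F : ℂ → ℂ} {C : ℝ} {w : ℂ}, ‖F w‖ ≤ C * √(1 + ‖w‖) → 0 ≤ C := by
    intro F C w h
    by_contra hC
    push Not at hC
    have h1 : 0 < √(1 + ‖w‖) := by positivity
    nlinarith [norm_nonneg (F w)]
  have hC1 := growthpos (hfg c hcre.ge)
  have hC2 := growthpos (hRg c hcre.ge)
  have hC3 := growthpos (hLg c hcre.le)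
  have shg : ∀ {F : ℂ → ℂ} {C : ℝ} (z : ℂ), 0 ≤ C → ‖F (c + z)‖ ≤ C * √(1 + ‖c + z‖) →
      ‖F (c + z)‖ ≤ (C * √(1 + ‖c‖)) * √(1 + ‖z‖) := by
    intro F C z hC h
    refine h.trans ?_
    rw [mul_assoc]
    exact mul_le_mul_of_nonneg_left (sqrt_shift c z) hC
  have dsh : ∀ {F : ℂ → ℂ} (z : ℂ), DifferentiableAt ℂ F (c + z) →
      DifferentiableAt ℂ (fun z => F (c + z)) z := by
    intro F z h
    exact DifferentiableAt.comp z h (by fun_prop)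
  obtain ⟨i1, e1⟩ := poisson_right (Φ := fun z => f (c + z)) (C := C1 * √(1 + ‖c‖)) hb
    (fun z hz => dsh z (hfd _ (by simp [hcre, hz])))
    (fun z hz => shg z hC1 (hfg _ (by simp [hcre, hz])))
  obtain ⟨i2, e2⟩ := poisson_right (Φ := fun z => FR (c + z)) (C := C2 * √(1 + ‖c‖)) hb
    (fun z hz => dsh z (hRd _ (by simp [hcre, hz])))
    (fun z hz => shg z hC2 (hRg _ (by simp [hcre, hz])))
  obtain ⟨i3, e3⟩ := poisson_left (Φ := fun z => FL (c + z)) (C := C3 * √(1 + ‖c‖)) hb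
    (fun z hz => dsh z (hLd _ (by simp [hcre, hz])))
    (fun z hz => shg z hC3 (hLg _ (by simp [hcre, hz])))
  obtain ⟨i4, e4⟩ := poisson_right (Φ := fun z => f (c + z) * exp (-(z * L)))
    (C := C1 * √(1 + ‖c‖)) hb
    (fun z hz => (dsh z (hfd _ (by simp [hcre, hz]))).mul (by fun_prop))
    (fun z hz => by
      rw [norm_mul, Complex.norm_exp]
      have h1 : Real.exp (-(z * L)).re ≤ 1 := by
        rw [Real.exp_le_one_iff]; simp; positivity
      have h2 := shg z hC1 (hfg (c + z) (by simp [hcre, hz]))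
      exact (mul_le_of_le_one_right (norm_nonneg _) h1).trans h2)
  have i5 := (LinearIsometryEquiv.integrable_comp_iff Complex.conjLIE).mpr i4
  have e5 : ∫ x : ℝ, (starRingEnd ℂ) (f (c + x * I) * exp (-(x * I * L)) / ((b ^ 2 + x ^ 2 : ℝ) : ℂ))
      = (starRingEnd ℂ) ((Real.pi / b : ℝ) * (f (c + b) * exp (-(b * L)))) := by
    rw [integral_conj, e4]
  have hJ : ∫ x : ℝ, (exp (-(c * L)) * (FR (c + x * I) / ((b ^ 2 + x ^ 2 : ℝ) : ℂ) +
        FL (c + x * I) / ((b ^ 2 + x ^ 2 : ℝ) : ℂ)) +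
        (starRingEnd ℂ) (f (c + x * I) * exp (-(x * I * L)) / ((b ^ 2 + x ^ 2 : ℝ) : ℂ)))
      = (Real.pi / b : ℝ) * (exp (-(c * L)) * (FR (c + b) + FL (c - b)) +
          exp (-(b * L)) * (starRingEnd ℂ) (f (c + b))) := by
    have h0 := integral_add ((i2.add i3).const_mul (exp (-(c * L)))) i5
    have h00 := integral_add i2 i3
    rw [e2, e3] at h00
    refine h0.trans ?_
    rw [integral_const_mul]
    refine (congrArg₂ (fun x y => exp (-(c * L)) * x + y) h00 e5).trans ?_
    simp only [map_mul, conj_ofReal, ← Complex.exp_conj, map_neg]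
    ring_nf
  have hre : ∫ x : ℝ, (f (c + x * I)).re / (b ^ 2 + x ^ 2) = Real.pi / b * (f (c + b)).re := by
    have h1 : ∫ x : ℝ, (f (c + x * I) / ((b ^ 2 + x ^ 2 : ℝ) : ℂ)).re = _ := integral_re i1
    rw [e1] at h1
    simp only [div_ofReal_re] at h1
    rw [h1]
    simp
  have i1r : Integrable fun x : ℝ => (f (c + x * I)).re / (b ^ 2 + x ^ 2) := by
    have := i1.re
    refine this.congr (ae_of_all _ fun x => ?_)
    simp only [RCLike.re_to_complex, div_ofReal_re]
  have hbd : ∀ x : ℝ, ‖exp (-(c * L)) * (FR (c + x * I) / ((b ^ 2 + x ^ 2 : ℝ) : ℂ) +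
        FL (c + x * I) / ((b ^ 2 + x ^ 2 : ℝ) : ℂ)) +
        (starRingEnd ℂ) (f (c + x * I) * exp (-(x * I * L)) / ((b ^ 2 + x ^ 2 : ℝ) : ℂ))‖
      ≤ 2 * ((f (c + x * I)).re / (b ^ 2 + x ^ 2)) +
        η * Real.exp (-((1 - b) * L)) * (√(1 + ‖c + x * I‖) / (b ^ 2 + x ^ 2)) := by
    intro x
    have hK : 0 < b ^ 2 + x ^ 2 := by positivity
    have hw : (c + x * I).re = 1 - b := by simp [hcre]
    have hr := hrem (c + x * I) hw
    have hp := hpos (t + x)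
    have ew : ((1 - b : ℝ) : ℂ) + ((t + x : ℝ) : ℂ) * I = c + x * I := by rw [hc]; push_cast; ring
    rw [ew] at hp
    set w := c + x * I with hwdef
    have eE : exp (-(c * L)) * exp (w * L) = exp (x * I * L) := by
      rw [← Complex.exp_add]; congr 1; rw [hwdef]; ring
    have econj : (starRingEnd ℂ) (exp (-(x * I * L))) = exp (x * I * L) := by
      rw [← Complex.exp_conj]; simp
    have key : exp (-(c * L)) * (FR w / ((b ^ 2 + x ^ 2 : ℝ) : ℂ) +
        FL w / ((b ^ 2 + x ^ 2 : ℝ) : ℂ)) +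
        (starRingEnd ℂ) (f w * exp (-(x * I * L)) / ((b ^ 2 + x ^ 2 : ℝ) : ℂ)) =
        (exp (x * I * L) * ((2 * (f w).re : ℝ) : ℂ) -
          exp (-(c * L)) * (f w * exp (w * L) - FR w - FL w)) / ((b ^ 2 + x ^ 2 : ℝ) : ℂ) := by
      rw [map_div₀, map_mul, econj, conj_ofReal, ← add_conj, mul_sub, mul_sub, mul_left_comm, eE]
      ring
    rw [key, norm_div, Complex.norm_real, Real.norm_of_nonneg hK.le]
    have h1 : ‖exp (x * I * L) * ((2 * (f w).re : ℝ) : ℂ)‖ = 2 * (f w).re := by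
      rw [norm_mul, Complex.norm_exp, Complex.norm_real, Real.norm_of_nonneg (by linarith)]
      simp
    have h2 : ‖exp (-(c * L)) * (f w * exp (w * L) - FR w - FL w)‖ ≤
        Real.exp (-((1 - b) * L)) * (η * √(1 + ‖w‖)) := by
      rw [norm_mul, Complex.norm_exp]
      have : (-(c * L)).re = -((1 - b) * L) := by simp [hcre]
      rw [this]
      exact mul_le_mul_of_nonneg_left hr (Real.exp_pos _).le
    have h3 := (norm_sub_le (exp (x * I * L) * ((2 * (f w).re : ℝ) : ℂ))
      (exp (-(c * L)) * (f w * exp (w * L) - FR w - FL w))).trans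
      (add_le_add h1.le h2)
    calc _ ≤ (2 * (f w).re + Real.exp (-((1 - b) * L)) * (η * √(1 + ‖w‖))) / (b ^ 2 + x ^ 2) := by
            gcongr
      _ = _ := by ring
  have hmain := norm_integral_le_of_norm_le
    ((i1r.const_mul 2).add ((MM_integrable hb c).const_mul (η * Real.exp (-((1 - b) * L)))))
    (ae_of_all _ hbd)
  rw [hJ] at hmain
  have hrhs := integral_add (i1r.const_mul 2)
    ((MM_integrable hb c).const_mul (η * Real.exp (-((1 - b) * L))))
  simp only [Pi.add_apply] at hmain
  rw [hrhs, integral_const_mul, integral_const_mul, hre, norm_mul, Complex.norm_real,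
    Real.norm_of_nonneg (by positivity)] at hmain
  change _ ≤ 2 * (Real.pi / b * (f (c + b)).re) + η * Real.exp (-((1 - b) * L)) * MM b c at hmain
  have hpi := Real.pi_pos
  have h1 : ∀ y : ℝ, y = b / Real.pi * (Real.pi / b * y) := by
    intro y; field_simp
  rw [h1 ‖_‖]
  calc _ ≤ b / Real.pi * (2 * (Real.pi / b * (f (c + b)).re) + η * Real.exp (-((1 - b) * L)) * MM b c) :=
        mul_le_mul_of_nonneg_left hmain (by positivity)
    _ = _ := by field_simp

end ZRH

namespace ZRH
open MeasureTheory Filter Topology Set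

/-- divided difference of `X ^ w`, `X = exp L` -/
noncomputable def EE (L : ℝ) (p w : ℂ) : ℂ := dslope (fun w : ℂ => exp (w * L)) p w

lemma EE_diff (L : ℝ) (p : ℂ) : Differentiable ℂ (EE L p) := by
  have h : DifferentiableOn ℂ (dslope (fun w : ℂ => exp (w * L)) p) univ :=
    (Complex.differentiableOn_dslope univ_mem).mpr (by fun_prop)
  exact differentiableOn_univ.mp h

lemma EE_ne {L : ℝ} {p w : ℂ} (h : w ≠ p) : EE L p w = (exp (w * L) - exp (p * L)) / (w - p) := by
  rw [EE, dslope_of_ne _ h, slope_def_field]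

lemma EE_same {L : ℝ} {p : ℂ} : EE L p p = exp (p * L) * L := by
  rw [EE, dslope_same]
  have : HasDerivAt (fun w : ℂ => exp (w * L)) (exp (p * L) * (1 * L)) p :=
    ((hasDerivAt_id p).mul_const (L : ℂ)).cexp
  rw [this.deriv, one_mul]

lemma EE_bound {L M : ℝ} (hL : 0 < L) {p w : ℂ} (hp : p.re ≤ M) (hw : w.re ≤ M) :
    ‖EE L p w‖ ≤ Real.exp (M * L) * L := by
  have hd : ∀ x : ℂ, HasDerivAt (fun w : ℂ => exp (w * L)) (exp (x * L) * (1 * L)) x := fun x =>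
    ((hasDerivAt_id x).mul_const (L : ℂ)).cexp
  have hb : ∀ x : ℂ, x.re ≤ M → ‖exp (x * L) * (1 * L)‖ ≤ Real.exp (M * L) * L := by
    intro x hx
    rw [norm_mul, Complex.norm_exp, one_mul, Complex.norm_real, Real.norm_of_nonneg hL.le]
    gcongr
    simp
    gcongr
  by_cases h : w = p
  · subst h
    rw [EE_same]
    simpa using hb w hw
  rw [EE_ne h, norm_div, div_le_iff₀ (norm_pos_iff.mpr (sub_ne_zero.mpr h))]
  exact (convex_halfSpace_re_le M).norm_image_sub_le_of_norm_hasDerivWithin_le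
    (fun x _ => (hd x).hasDerivWithinAt) (fun x hx => hb x hx) hp hw

/-- von Mangoldt as a complex function -/
noncomputable def vM (n : ℕ) : ℂ := (ArithmeticFunction.vonMangoldt n : ℂ)

/-- Dirichlet polynomial -/
noncomputable def DD (L : ℝ) (w : ℂ) : ℂ :=
  ∑ n ∈ Finset.range (⌊Real.exp L⌋₊ + 1), LSeries.term vM w n

lemma DD_diff (L : ℝ) : Differentiable ℂ (DD L) := by
  unfold DD
  refine Differentiable.fun_sum (fun n _ => ?_)
  by_cases hn : n = 0
  · subst hn; simp
  · simp only [LSeries.term_of_ne_zero hn]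
    have : (n : ℂ) ≠ 0 := by exact_mod_cast hn
    intro w
    refine DifferentiableAt.div (by fun_prop) ?_ ?_
    · exact DifferentiableAt.const_cpow differentiableAt_id (Or.inl this)
    · simp [Complex.cpow_eq_zero_iff, this]

lemma DD_bound {L : ℝ} {w : ℂ} (a : ℝ) (hw : a ≤ w.re) :
    ‖DD L w‖ ≤ ∑ n ∈ Finset.range (⌊Real.exp L⌋₊ + 1), ‖LSeries.term vM a n‖ := by
  refine (norm_sum_le _ _).trans (Finset.sum_le_sum fun n _ => ?_)
  exact LSeries.norm_term_le_of_re_le_re vM (by simpa using hw) n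

lemma XD_bound {L : ℝ} {w : ℂ} (hL : 0 < L) (hw : w.re ≤ 1) :
    ‖exp (w * L) * DD L w‖ ≤ Real.exp L * ∑ n ∈ Finset.range (⌊Real.exp L⌋₊ + 1), ‖LSeries.term vM 1 n‖ := by
  rw [DD, Finset.mul_sum, Finset.mul_sum]
  refine (norm_sum_le _ _).trans (Finset.sum_le_sum fun n hn => ?_)
  by_cases h0 : n = 0
  · subst h0; simp
  have hn1 : (n : ℝ) ≤ Real.exp L := by
    have : n ≤ ⌊Real.exp L⌋₊ := Nat.lt_succ_iff.mp (Finset.mem_range.mp hn)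
    exact (Nat.le_floor_iff (Real.exp_pos L).le).mp this
  have hn0 : (0:ℝ) < n := by positivity
  rw [norm_mul, LSeries.norm_term_eq, LSeries.norm_term_eq, if_neg h0, if_neg h0, Complex.norm_exp]
  have h1 : Real.log n ≤ L := by
    rw [Real.log_le_iff_le_exp hn0]; exact hn1
  have e : ∀ r : ℝ, Real.exp (r * L) * (‖vM n‖ / (n:ℝ) ^ r) = ‖vM n‖ * Real.exp (r * (L - Real.log n)) := by
    intro r
    rw [Real.rpow_def_of_pos hn0, mul_sub, Real.exp_sub, mul_comm (Real.log n)]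
    ring
  have e1 := e 1
  rw [one_mul] at e1
  have e2 : (w * L).re = w.re * L := by simp
  rw [e2, e, one_re, e1]
  gcongr

lemma XD_tail {L : ℝ} {w : ℂ} (hL : 0 < L) (hw : 2 ≤ w.re) :
    ‖exp (w * L) * (deriv riemannZeta w / riemannZeta w + DD L w)‖ ≤
      Real.exp (2 * L) * ∑' n, ‖LSeries.term vM 2 (n + (⌊Real.exp L⌋₊ + 1))‖ := by
  have hs2 : LSeriesSummable vM 2 :=
    ArithmeticFunction.LSeriesSummable_vonMangoldt (by norm_num)
  have hsw : LSeriesSummable vM w :=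
    ArithmeticFunction.LSeriesSummable_vonMangoldt (by linarith)
  have h := ArithmeticFunction.LSeries_vonMangoldt_eq_deriv_riemannZeta_div (s := w) (by linarith)
  have hh : LSeries vM w = - deriv riemannZeta w / riemannZeta w := h
  have h3 := hsw.sum_add_tsum_nat_add (⌊Real.exp L⌋₊ + 1)
  have h4 : deriv riemannZeta w / riemannZeta w + DD L w =
      - ∑' n, LSeries.term vM w (n + (⌊Real.exp L⌋₊ + 1)) := by
    have : deriv riemannZeta w / riemannZeta w = - LSeries vM w := by rw [hh]; ring
    rw [this, LSeries, ← h3, DD]; ring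
  rw [h4, mul_neg, norm_neg, ← tsum_mul_left, ← tsum_mul_left]
  have hsum := (((summable_nat_add_iff (⌊Real.exp L⌋₊ + 1)).mpr hs2.norm).mul_left (Real.exp (2 * L)))
  refine tsum_of_norm_bounded hsum.hasSum (fun m => ?_)
  set n := m + (⌊Real.exp L⌋₊ + 1) with hn
  have h0 : n ≠ 0 := by omega
  have hn1 : Real.exp L ≤ n := by
    have := (Nat.lt_floor_add_one (Real.exp L)).le
    rw [hn]; push_cast; linarith [(Nat.cast_nonneg m : (0:ℝ) ≤ m)]
  have hn0 : (0:ℝ) < n := by positivity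
  rw [norm_mul, LSeries.norm_term_eq, LSeries.norm_term_eq, if_neg h0, if_neg h0, Complex.norm_exp]
  have h1 : L ≤ Real.log n := by
    rw [Real.le_log_iff_exp_le hn0]; exact hn1
  have e : ∀ r : ℝ, Real.exp (r * L) * (‖vM n‖ / (n:ℝ) ^ r) = ‖vM n‖ * Real.exp (r * (L - Real.log n)) := by
    intro r
    rw [Real.rpow_def_of_pos hn0, mul_sub, Real.exp_sub, mul_comm (Real.log n)]
    ring
  have e2 : (w * L).re = w.re * L := by simp
  have e3 : (2:ℂ).re = 2 := rfl
  rw [e2, e, e3, e]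
  gcongr ?_ * Real.exp ?_
  nlinarith

/-- right part -/
noncomputable def FR (L : ℝ) (N : ℕ) (w : ℂ) : ℂ :=
  exp (w * L) * (zz w + DD L w) - EE L 1 w
    - ∑ k ∈ Finset.range N, exp (-((2 * (k + 1) : ℝ) : ℂ) * L) / (w + (2 * (k + 1) : ℝ))

/-- left part -/
noncomputable def FL (L : ℝ) (N : ℕ) (w : ℂ) : ℂ :=
  - (exp (w * L) * DD L w) + EE L 1 w + exp (w * L) * gc
    + ∑ k ∈ Finset.range N, (exp (w * L) / ((2 * (k + 1) : ℝ) : ℂ) - EE L (-((2 * (k + 1) : ℝ) : ℂ)) w)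

lemma one_le_sq (w : ℂ) : 1 ≤ √(1 + ‖w‖) := by
  rw [Real.one_le_sqrt]; linarith [norm_nonneg w]

lemma wk_norm {w : ℂ} (hw : 0 ≤ w.re) (k : ℕ) : (2 * (k + 1) : ℝ) ≤ ‖w + (2 * (k + 1) : ℝ)‖ := by
  refine le_trans ?_ (re_le_norm _)
  rw [add_re, ofReal_re]; linarith

lemma wk_ne {w : ℂ} (hw : 0 ≤ w.re) (k : ℕ) : w + (2 * (k + 1) : ℝ) ≠ 0 := by
  have := wk_norm hw k
  have h2 : (0:ℝ) < 2 * (k + 1) := by positivity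
  exact norm_pos_iff.mp (by linarith)

lemma FR_diff (RH : RiemannHypothesis) (L : ℝ) (N : ℕ) {w : ℂ} (hw : 1 / 2 < w.re) :
    DifferentiableAt ℂ (FR L N) w := by
  unfold FR
  refine DifferentiableAt.sub (DifferentiableAt.sub (DifferentiableAt.mul (by fun_prop)
    ((zz_diff RH hw).add (DD_diff L w))) (EE_diff L 1 w)) ?_
  refine DifferentiableAt.fun_sum (fun k _ => ?_)
  exact DifferentiableAt.div (by fun_prop) (by fun_prop) (wk_ne (by linarith) k)

lemma FL_diff (L : ℝ) (N : ℕ) (w : ℂ) : DifferentiableAt ℂ (FL L N) w := by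
  unfold FL
  have h1 := DD_diff L w
  have h2 := EE_diff L 1 w
  refine DifferentiableAt.add (by fun_prop) ?_
  refine DifferentiableAt.fun_sum (fun k _ => ?_)
  exact DifferentiableAt.sub (by fun_prop) (EE_diff L _ w)

lemma FL_growth {L : ℝ} (hL : 0 < L) (N : ℕ) :
    ∃ C : ℝ, ∀ w : ℂ, w.re ≤ 1 → ‖FL L N w‖ ≤ C * √(1 + ‖w‖) := by
  have h1 : ∃ C : ℝ, 0 ≤ C ∧ ∀ w : ℂ, w.re ≤ 1 → ‖FL L N w‖ ≤ C := by
    refine ⟨Real.exp L * ∑ n ∈ Finset.range (⌊Real.exp L⌋₊ + 1), ‖LSeries.term vM 1 n‖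
      + Real.exp (1 * L) * L + Real.exp L * |gc| + ∑ k ∈ Finset.range N, (Real.exp L + Real.exp (1 * L) * L),
      by positivity, fun w hw => ?_⟩
    unfold FL
    have hX : ‖exp (w * L)‖ ≤ Real.exp L := by
      rw [Complex.norm_exp]; gcongr; simp; nlinarith
    refine (norm_add_le _ _).trans (add_le_add ((norm_add_le _ _).trans (add_le_add
      ((norm_add_le _ _).trans (add_le_add ?_ ?_)) ?_)) ?_)
    · rw [norm_neg]; exact XD_bound hL hw
    · exact EE_bound hL (by simp) hw
    · rw [norm_mul, Complex.norm_real, Real.norm_eq_abs]; gcongr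
    · refine (norm_sum_le _ _).trans (Finset.sum_le_sum fun k _ => ?_)
      refine (norm_sub_le _ _).trans (add_le_add ?_ ?_)
      · rw [norm_div, Complex.norm_real, Real.norm_of_nonneg (by positivity)]
        refine (div_le_self (norm_nonneg _) ?_).trans hX
        linarith [(Nat.cast_nonneg k : (0:ℝ) ≤ k)]
      · refine EE_bound hL ?_ hw
        rw [neg_re, ofReal_re]
        linarith [(Nat.cast_nonneg k : (0:ℝ) ≤ k)]
  obtain ⟨C, hC, h⟩ := h1
  exact ⟨C, fun w hw => (h w hw).trans (le_mul_of_one_le_right hC (one_le_sq w))⟩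

lemma FR_growth (RH : RiemannHypothesis) {L a : ℝ} (hL : 0 < L) (ha : 1 / 2 < a) (N : ℕ) :
    ∃ C : ℝ, ∀ w : ℂ, a ≤ w.re → ‖FR L N w‖ ≤ C * √(1 + ‖w‖) := by
  obtain ⟨Cz, hCz, hz⟩ := zz_growth RH ha
  set D0 := ∑ n ∈ Finset.range (⌊Real.exp L⌋₊ + 1), ‖LSeries.term vM a n‖ with hD0
  set T0 := Real.exp (2 * L) * ∑' n, ‖LSeries.term vM 2 (n + (⌊Real.exp L⌋₊ + 1))‖ with hT0
  have hD00 : 0 ≤ D0 := by positivity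
  have hT00 : 0 ≤ T0 := by
    refine mul_nonneg (by positivity) (tsum_nonneg fun _ => norm_nonneg _)
  set A := Real.exp (2 * L) * (Cz + D0) + Real.exp (2 * L) * L with hA
  have hA0 : 0 ≤ A := by positivity
  refine ⟨A + (T0 + Real.exp L) + N, fun w hw => ?_⟩
  have h1 := one_le_sq w
  have hsum : ‖∑ k ∈ Finset.range N, exp (-((2 * (k + 1) : ℝ) : ℂ) * L) / (w + (2 * (k + 1) : ℝ))‖ ≤ N := by
    refine (norm_sum_le _ _).trans ?_
    refine (Finset.sum_le_sum (g := fun _ => (1:ℝ)) fun k _ => ?_).trans (by simp)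
    rw [norm_div, Complex.norm_exp]
    have h2 := wk_norm (w := w) (by linarith) k
    have h3 := (Nat.cast_nonneg k : (0:ℝ) ≤ k)
    rw [div_le_one (by linarith)]
    have : Real.exp (-((2 * (k + 1) : ℝ) : ℂ) * L).re ≤ 1 := by
      rw [Real.exp_le_one_iff, ← ofReal_neg, ← ofReal_mul, ofReal_re]
      nlinarith
    linarith
  have hmain : ‖exp (w * L) * (zz w + DD L w) - EE L 1 w‖ ≤ (A + (T0 + Real.exp L)) * √(1 + ‖w‖) := by
    by_cases hw2 : 2 ≤ w.re
    · have hw1 : w ≠ 1 := by rintro rfl; norm_num at hw2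
      have h0 : riemannZeta w ≠ 0 := by
        have := zeta_ne_two hw2
        intro h; rw [h] at this; norm_num at this
      have e : exp (w * L) * (zz w + DD L w) - EE L 1 w =
          exp (w * L) * (deriv riemannZeta w / riemannZeta w + DD L w) + exp (1 * L) / (w - 1) := by
        rw [zz_eq hw1 h0, EE_ne hw1]; ring
      rw [e]
      have h2 : ‖exp (1 * L : ℂ) / (w - 1)‖ ≤ Real.exp L := by
        rw [norm_div, Complex.norm_exp]
        have : 1 ≤ ‖w - 1‖ := by
          refine le_trans ?_ (re_le_norm _); simp; linarith
        refine (div_le_self (Real.exp_pos _).le this).trans ?_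
        simp
      have h3 := (norm_add_le _ _).trans (add_le_add (XD_tail hL hw2) h2)
      refine h3.trans ?_
      have : 0 ≤ T0 + Real.exp L := by positivity
      rw [← hT0]
      nlinarith
    · push Not at hw2
      have hX : ‖exp (w * L)‖ ≤ Real.exp (2 * L) := by
        rw [Complex.norm_exp]; gcongr; simp; nlinarith
      have h2 : ‖EE L 1 w‖ ≤ Real.exp (2 * L) * L := EE_bound hL (by simp) hw2.le
      have h3 : ‖zz w + DD L w‖ ≤ (Cz + D0) * √(1 + ‖w‖) := by
        refine (norm_add_le _ _).trans ((add_le_add (hz w hw) (DD_bound a hw)).trans ?_)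
        rw [← hD0]; nlinarith
      have h4 : ‖exp (w * L) * (zz w + DD L w)‖ ≤ Real.exp (2 * L) * ((Cz + D0) * √(1 + ‖w‖)) := by
        rw [norm_mul]; gcongr
      refine (norm_sub_le _ _).trans ((add_le_add h4 h2).trans ?_)
      have h5 : Real.exp (2 * L) * L ≤ Real.exp (2 * L) * L * √(1 + ‖w‖) :=
        le_mul_of_one_le_right (by positivity) h1
      have : 0 ≤ (T0 + Real.exp L) * √(1 + ‖w‖) := by positivity
      rw [hA]
      nlinarith
  unfold FR
  refine (norm_sub_le _ _).trans ((add_le_add hmain hsum).trans ?_)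
  have : (N:ℝ) ≤ N * √(1 + ‖w‖) := le_mul_of_one_le_right (by positivity) h1
  nlinarith

end ZRH

namespace ZRH
open MeasureTheory Filter Topology Set

lemma line_identity {L : ℝ} (N : ℕ) {w : ℂ} (hw : 0 ≤ w.re) :
    ff w * exp (w * L) - FR L N w - FL L N w =
      exp (w * L) * (g0 w - gc - ∑ k ∈ Finset.range N, gk k w) := by
  have h : ∀ k : ℕ, exp (w * L) / ((2 * (k + 1) : ℝ) : ℂ) - EE L (-((2 * (k + 1) : ℝ) : ℂ)) w =
      exp (w * L) * gk k w + exp (-((2 * (k + 1) : ℝ) : ℂ) * L) / (w + (2 * (k + 1) : ℝ)) := by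
    intro k
    have h1 := wk_ne hw k
    have h2 : w ≠ -((2 * (k + 1) : ℝ) : ℂ) := fun h => h1 (by rw [h]; ring)
    rw [EE_ne h2, gk, sub_neg_eq_add]
    ring
  unfold FR FL ff
  simp only [h, Finset.sum_add_distrib, ← Finset.mul_sum]
  ring

/-- trivial zero sum -/
noncomputable def tau (L : ℝ) (N : ℕ) (w v : ℂ) : ℂ := ∑ k ∈ Finset.range N,
  exp (-((2 * (k + 1) : ℝ) : ℂ) * L) * (1 / (v + (2 * (k + 1) : ℝ)) - 1 / (w + (2 * (k + 1) : ℝ)))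

lemma tau_bound {L : ℝ} (hL : 0 < L) (N : ℕ) {w v : ℂ} (hw : 0 ≤ w.re) (hv : 0 ≤ v.re)
    (h1 : ‖w - v‖ ≤ 1) : ‖tau L N w v‖ ≤ 1 := by
  have hs : ∀ N : ℕ, ∑ k ∈ Finset.range N, (1 / (4 * ((k:ℝ) + 1) ^ 2)) ≤ 1 - 1 / ((N:ℝ) + 1) := by
    intro N
    induction N with
    | zero => simp
    | succ n ih =>
      rw [Finset.sum_range_succ]
      have : 1 / (4 * ((n:ℝ) + 1) ^ 2) ≤ 1 / ((n:ℝ) + 1) - 1 / ((n:ℝ) + 1 + 1) := by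
        rw [div_sub_div _ _ (by positivity) (by positivity), div_le_div_iff₀ (by positivity) (by positivity)]
        have := (Nat.cast_nonneg n : (0:ℝ) ≤ n)
        nlinarith
      push_cast
      linarith
  have hN : (0:ℝ) ≤ 1 / ((N:ℝ) + 1) := by positivity
  refine le_trans ?_ ((hs N).trans (by linarith))
  refine (norm_sum_le _ _).trans (Finset.sum_le_sum fun k _ => ?_)
  have h3 := (Nat.cast_nonneg k : (0:ℝ) ≤ k)
  rw [norm_mul, Complex.norm_exp]
  have he : Real.exp (-((2 * (k + 1) : ℝ) : ℂ) * L).re ≤ 1 := by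
    rw [Real.exp_le_one_iff, ← ofReal_neg, ← ofReal_mul, ofReal_re]
    nlinarith
  have e : 1 / (v + (2 * (k + 1) : ℝ)) - 1 / (w + (2 * (k + 1) : ℝ)) =
      (w - v) / ((v + (2 * (k + 1) : ℝ)) * (w + (2 * (k + 1) : ℝ))) := by
    have := wk_ne hw k
    have := wk_ne hv k
    rw [div_sub_div _ _ (by assumption) (by assumption)]
    ring
  refine (mul_le_of_le_one_left (norm_nonneg _) he).trans ?_
  rw [e, norm_div, norm_mul]
  refine div_le_div₀ zero_le_one h1 (by positivity) ?_
  have := wk_norm hw k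
  have := wk_norm hv k
  calc 4 * ((k:ℝ) + 1) ^ 2 = (2 * (k + 1)) * (2 * (k + 1)) := by ring
    _ ≤ _ := by gcongr

/-- the main quantity -/
noncomputable def VV (L : ℝ) (w v : ℂ) : ℂ :=
  exp (w * L) * (zz w + DD L w) - EE L 1 w - exp (v * L) * DD L v + EE L 1 v + exp (v * L) * g0 v

lemma FRFL {L : ℝ} (N : ℕ) {w v : ℂ} (hv : 0 ≤ v.re) :
    FR L N w + FL L N v = VV L w v + tau L N w v -
      exp (v * L) * (g0 v - gc - ∑ k ∈ Finset.range N, gk k v) := by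
  have h : ∀ k : ℕ, exp (v * L) / ((2 * (k + 1) : ℝ) : ℂ) - EE L (-((2 * (k + 1) : ℝ) : ℂ)) v =
      exp (v * L) * gk k v + exp (-((2 * (k + 1) : ℝ) : ℂ) * L) / (v + (2 * (k + 1) : ℝ)) := by
    intro k
    have h1 := wk_ne hv k
    have h2 : v ≠ -((2 * (k + 1) : ℝ) : ℂ) := fun h => h1 (by rw [h]; ring)
    rw [EE_ne h2, gk, sub_neg_eq_add]
    ring
  have h2 : tau L N w v = (∑ k ∈ Finset.range N, exp (-((2 * (k + 1) : ℝ) : ℂ) * L) / (v + (2 * (k + 1) : ℝ)))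
      - ∑ k ∈ Finset.range N, exp (-((2 * (k + 1) : ℝ) : ℂ) * L) / (w + (2 * (k + 1) : ℝ)) := by
    rw [tau, ← Finset.sum_sub_distrib]
    refine Finset.sum_congr rfl fun k _ => ?_
    ring
  rw [h2]
  unfold FR FL VV
  simp only [h, Finset.sum_add_distrib, ← Finset.mul_sum]
  ring

lemma FI_a (RH : RiemannHypothesis) {L b : ℝ} (hL : 0 < L) (hb : 1 / 4 ≤ b) (hb1 : b < 1 / 2)
    (t : ℝ) {w v c : ℂ} (hw : w = 1 + t * I) (hv : v = (1 - 2 * b : ℝ) + t * I)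
    (hc : c = (1 - b : ℝ) + t * I) :
    ‖exp (-(c * L)) * VV L w v + exp (-(b * L)) * (starRingEnd ℂ) (ff w)‖
      ≤ 2 * (ff w).re + Real.exp (-((1 - b) * L)) := by
  have hwre : w.re = 1 := by simp [hw]
  have hvre : v.re = 1 - 2 * b := by simp [hv]
  have hcre : c.re = 1 - b := by simp [hc]
  have ecw : c + b = w := by rw [hc, hw]; push_cast; ring
  have ecv : c - b = v := by rw [hc, hv]; push_cast; ring
  obtain ⟨C1, hC1, h1⟩ := ff_growth RH (a := 1 - b) (by linarith)
  set M := (b / Real.pi) * Real.exp (-((1 - b) * L)) * MM b c with hM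
  set nv := Real.exp (-((1 - b) * L)) * (Real.exp ((1 - 2 * b) * L) * √(1 + ‖v‖)) with hnv
  have hfin : ∀ N : ℕ, ‖exp (-(c * L)) * VV L w v + exp (-(b * L)) * (starRingEnd ℂ) (ff w)‖
      ≤ 2 * (ff w).re + Real.exp (-((1 - b) * L)) + gη N * (Real.exp ((1 - b) * L) * M + nv) := by
    intro N
    obtain ⟨C2, h2⟩ := FR_growth RH hL (a := 1 - b) (by linarith) N
    obtain ⟨C3, h3⟩ := FL_growth hL N
    have hB := lemB (f := ff) (FR := FR L N) (FL := FL L N) (η := gη N * Real.exp ((1 - b) * L))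
      (C1 := C1) (C2 := C2) (C3 := C3) (b := b) (t := t) (c := c) hL (by linarith) hc
      (mul_nonneg (gη_nonneg N) (Real.exp_pos _).le)
      (fun w hw => (zz_diff RH (by linarith)).add (g0_diff (by linarith)))
      h1
      (fun y => ff_pos RH (by linarith) (by linarith) y)
      (fun w hw => FR_diff RH L N (by linarith))
      h2
      (fun w hw => FL_diff L N w)
      (fun w hw => h3 w (by linarith))
      (fun w hw => by
        rw [line_identity N (by linarith), norm_mul, Complex.norm_exp]
        have e : (w * L).re = (1 - b) * L := by simp [hw]
        rw [e]
        have := g0_tail (w := w) (by linarith) N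
        calc _ ≤ Real.exp ((1 - b) * L) * (gη N * √(1 + ‖w‖)) := by gcongr
          _ = _ := by ring)
    rw [ecw, ecv, FRFL N (by linarith : 0 ≤ v.re)] at hB
    have ht := tau_bound hL N (w := w) (v := v) (by linarith) (by linarith) (by
      have : w - v = ((2 * b : ℝ) : ℂ) := by rw [hw, hv]; push_cast; ring
      rw [this, Complex.norm_real, Real.norm_of_nonneg (by linarith)]; linarith)
    have hg := g0_tail (w := v) (by linarith) N
    set δ := g0 v - gc - ∑ k ∈ Finset.range N, gk k v with hδ
    have e : exp (-(c * L)) * VV L w v + exp (-(b * L)) * (starRingEnd ℂ) (ff w) =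
        (exp (-(c * L)) * (VV L w v + tau L N w v - exp (v * L) * δ) +
          exp (-(b * L)) * (starRingEnd ℂ) (ff w)) - exp (-(c * L)) * tau L N w v
          + exp (-(c * L)) * (exp (v * L) * δ) := by ring
    have hce : ‖exp (-(c * L))‖ = Real.exp (-((1 - b) * L)) := by
      rw [Complex.norm_exp]; congr 1; simp [hcre]
    have hve : ‖exp (v * L)‖ = Real.exp ((1 - 2 * b) * L) := by
      rw [Complex.norm_exp]; congr 1; simp [hvre]
    have n1 : ‖exp (-(c * L)) * tau L N w v‖ ≤ Real.exp (-((1 - b) * L)) := by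
      rw [norm_mul, hce]; exact mul_le_of_le_one_right (Real.exp_pos _).le ht
    have n2 : ‖exp (-(c * L)) * (exp (v * L) * δ)‖ ≤ gη N * nv := by
      rw [norm_mul, norm_mul, hce, hve, hnv]
      calc _ ≤ Real.exp (-((1 - b) * L)) * (Real.exp ((1 - 2 * b) * L) * (gη N * √(1 + ‖v‖))) := by gcongr
        _ = _ := by ring
    rw [e]
    refine (norm_add_le _ _).trans ((add_le_add ((norm_sub_le _ _).trans (add_le_add hB n1)) n2).trans ?_)
    apply le_of_eq
    ring
  have hlim : Tendsto (fun N => 2 * (ff w).re + Real.exp (-((1 - b) * L)) + gη N * (Real.exp ((1 - b) * L) * M + nv))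
      atTop (𝓝 (2 * (ff w).re + Real.exp (-((1 - b) * L)) + 0 * (Real.exp ((1 - b) * L) * M + nv))) :=
    (gη_tendsto.mul_const _).const_add _
  have := ge_of_tendsto' hlim hfin
  simpa using this

lemma FI (RH : RiemannHypothesis) {L : ℝ} (hL : 0 < L) (t : ℝ) {w v : ℂ} (hw : w = 1 + t * I)
    (hv : v = t * I) :
    ‖exp (-(v * L)) * VV L w v + (starRingEnd ℂ) (ff w)‖
      ≤ 2 * Real.exp (L / 2) * (ff w).re + 1 := by
  set vb : ℝ → ℂ := fun b => (1 - 2 * b : ℝ) + t * I with hvb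
  set cb : ℝ → ℂ := fun b => (1 - b : ℝ) + t * I with hcb
  have hvh : vb (1 / 2) = v := by simp [hvb, hv]
  have cv : Continuous vb := by fun_prop
  have cc : Continuous cb := by fun_prop
  have cD : Continuous fun b => DD L (vb b) := (DD_diff L).continuous.comp cv
  have cE : Continuous fun b => EE L 1 (vb b) := (EE_diff L 1).continuous.comp cv
  have cg : ContinuousAt (fun b => g0 (vb b)) (1 / 2) := by
    refine ContinuousAt.comp (g := g0) ?_ cv.continuousAt
    rw [hvh]
    exact (g0_diff (by simp [hv])).continuousAt
  have c1 : ContinuousAt (fun b : ℝ => ‖exp (-(cb b * L)) * VV L w (vb b) + exp (-(b * L)) * (starRingEnd ℂ) (ff w)‖)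
      (1 / 2) := by
    unfold VV
    have a1 := cv.continuousAt (x := 1 / 2)
    have a2 := cc.continuousAt (x := 1 / 2)
    have a3 := cD.continuousAt (x := 1 / 2)
    have a4 := cE.continuousAt (x := 1 / 2)
    have a5 : ContinuousAt (fun b => exp (vb b * L)) (1 / 2) := by fun_prop
    have a6 : ContinuousAt (fun b => exp (-(cb b * L))) (1 / 2) := by fun_prop
    have a7 : ContinuousAt (fun b : ℝ => exp (-((b : ℂ) * L))) (1 / 2) := by fun_prop
    exact ((a6.mul (((continuousAt_const.sub (a5.mul a3)).add a4).add (a5.mul cg))).add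
      (a7.mul continuousAt_const)).norm
  have c2 : ContinuousAt (fun b : ℝ => 2 * (ff w).re + Real.exp (-((1 - b) * L))) (1 / 2) := by fun_prop
  have l1 := c1.tendsto.mono_left (nhdsWithin_le_nhds (s := Iio (1/2:ℝ)))
  have l2 := c2.tendsto.mono_left (nhdsWithin_le_nhds (s := Iio (1/2:ℝ)))
  have hev : ∀ᶠ b in 𝓝[<] (1 / 2 : ℝ), ‖exp (-(cb b * L)) * VV L w (vb b) + exp (-(b * L)) * (starRingEnd ℂ) (ff w)‖ ≤
      2 * (ff w).re + Real.exp (-((1 - b) * L)) := by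
    have h1 : ∀ᶠ b in 𝓝[<] (1 / 2 : ℝ), b < 1 / 2 := self_mem_nhdsWithin
    have h2 : ∀ᶠ b in 𝓝[<] (1 / 2 : ℝ), 1 / 4 < b :=
      nhdsWithin_le_nhds (Ioi_mem_nhds (by norm_num))
    filter_upwards [h1, h2] with b hb1 hb2
    exact FI_a RH hL hb2.le hb1 t hw rfl rfl
  have h := le_of_tendsto_of_tendsto l1 l2 hev
  rw [hvh] at h
  have e1 : exp (-(cb (1 / 2) * L)) = exp (-(v * L)) * ((Real.exp (-(L / 2)) : ℝ) : ℂ) := by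
    rw [ofReal_exp, ← Complex.exp_add]; congr 1; rw [hcb, hv]; push_cast; ring
  have e2 : exp (-(((1 / 2 : ℝ) : ℂ) * L)) = ((Real.exp (-(L / 2)) : ℝ) : ℂ) := by
    rw [ofReal_exp]; congr 1; push_cast; ring
  have e3 : Real.exp (-((1 - 1 / 2) * L)) = Real.exp (-(L / 2)) := by congr 1; ring
  have e4 : exp (-(v * L)) * ((Real.exp (-(L / 2)) : ℝ) : ℂ) * VV L w v +
      ((Real.exp (-(L / 2)) : ℝ) : ℂ) * (starRingEnd ℂ) (ff w) =
      ((Real.exp (-(L / 2)) : ℝ) : ℂ) * (exp (-(v * L)) * VV L w v + (starRingEnd ℂ) (ff w)) := by ring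
  rw [e1, e2, e3, e4, norm_mul, Complex.norm_real, Real.norm_of_nonneg (Real.exp_pos _).le] at h
  have h5 : Real.exp (L / 2) * Real.exp (-(L / 2)) = 1 := by rw [← Real.exp_add]; simp
  have h6 := mul_le_mul_of_nonneg_left h (Real.exp_pos (L / 2)).le
  rw [← mul_assoc, h5, one_mul, mul_add, h5] at h6
  linarith

end ZRH

namespace ZRH
open MeasureTheory Filter Topology Set

lemma h_est {x t : ℝ} (hx : 1 ≤ x) (ht : 0 < t) :
    |x / (x ^ 2 + t ^ 2) - (Real.log ((x + 1) ^ 2 + t ^ 2) - Real.log ((x - 1) ^ 2 + t ^ 2)) / 4|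
      ≤ 2 / ((x - 1) ^ 2 + t ^ 2) := by
  set A := (x + 1) ^ 2 + t ^ 2 with hA
  set B := (x - 1) ^ 2 + t ^ 2 with hB
  set C := x ^ 2 + t ^ 2 with hC
  have hA0 : 0 < A := by positivity
  have hB0 : 0 < B := by positivity
  have hC0 : 0 < C := by positivity
  have hAB : A - B = 4 * x := by rw [hA, hB]; ring
  have h1 : Real.log A - Real.log B ≤ 4 * x / B := by
    rw [← Real.log_div hA0.ne' hB0.ne']
    refine (Real.log_le_sub_one_of_pos (by positivity)).trans (le_of_eq ?_)
    rw [← hAB]; field_simp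
  have h2 : Real.log B - Real.log A ≤ -(4 * x / A) := by
    rw [← Real.log_div hB0.ne' hA0.ne']
    refine (Real.log_le_sub_one_of_pos (by positivity)).trans (le_of_eq ?_)
    rw [← hAB]; field_simp; ring
  have h3 : x / B - x / C ≤ 2 / B := by
    rw [sub_le_iff_le_add, ← sub_le_iff_le_add', ← sub_div, div_le_div_iff₀ hB0 hC0, hB, hC]
    nlinarith [sq_nonneg t]
  have h4 : x / C - x / A ≤ 2 / B := by
    have h5 : x / C - x / A ≤ 2 / C := by
      rw [sub_le_iff_le_add, ← sub_le_iff_le_add', ← sub_div, div_le_div_iff₀ hC0 hA0, hA, hC]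
      nlinarith [sq_nonneg t]
    refine h5.trans ?_
    apply div_le_div_of_nonneg_left (by norm_num) hB0
    rw [hB, hC]; nlinarith
  have e1 : 4 * x / B = 4 * (x / B) := by ring
  have e2 : 4 * x / A = 4 * (x / A) := by ring
  rw [abs_le]
  constructor <;> linarith

lemma h_sum {σ t : ℝ} (hσ : 0 ≤ σ) (ht : 200 ≤ t) (N : ℕ) :
    |∑ k ∈ Finset.range N, (σ + 2 * (k + 1)) / ((σ + 2 * (k + 1)) ^ 2 + t ^ 2) -
      (Real.log ((σ + 1 + 2 * N) ^ 2 + t ^ 2) - Real.log ((σ + 1) ^ 2 + t ^ 2)) / 4| ≤ 1 / 50 := by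
  have htel : ∀ N : ℕ, ∑ k ∈ Finset.range N, (1 / ((k:ℝ) + 100) - 1 / ((k:ℝ) + 101)) = 1 / 100 - 1 / ((N:ℝ) + 100) := by
    intro N
    induction N with
    | zero => simp
    | succ n ih => rw [Finset.sum_range_succ, ih]; push_cast; ring
  have hq : (Real.log ((σ + 1 + 2 * N) ^ 2 + t ^ 2) - Real.log ((σ + 1) ^ 2 + t ^ 2)) / 4 =
      ∑ k ∈ Finset.range N, (Real.log ((σ + 2 * (k + 1) + 1) ^ 2 + t ^ 2)
        - Real.log ((σ + 2 * (k + 1) - 1) ^ 2 + t ^ 2)) / 4 := by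
    rw [← Finset.sum_div]
    congr 1
    have := Finset.sum_range_sub (fun k : ℕ => Real.log ((σ + 1 + 2 * k) ^ 2 + t ^ 2)) N
    simp only [Nat.cast_zero, mul_zero, add_zero] at this
    rw [← this]
    refine Finset.sum_congr rfl fun k _ => ?_
    push_cast
    ring_nf
  rw [hq, ← Finset.sum_sub_distrib]
  refine (Finset.abs_sum_le_sum_abs _ _).trans ?_
  have hle : ∀ k ∈ Finset.range N, |(σ + 2 * ((k:ℝ) + 1)) / ((σ + 2 * (k + 1)) ^ 2 + t ^ 2) -
      (Real.log ((σ + 2 * (k + 1) + 1) ^ 2 + t ^ 2)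
        - Real.log ((σ + 2 * (k + 1) - 1) ^ 2 + t ^ 2)) / 4| ≤ 2 * (1 / ((k:ℝ) + 100) - 1 / ((k:ℝ) + 101)) := by
    intro k _
    have hk := (Nat.cast_nonneg k : (0:ℝ) ≤ k)
    refine (h_est (by linarith) (by linarith)).trans ?_
    rw [div_sub_div _ _ (by positivity) (by positivity)]
    have : 2 * ((1 * ((k:ℝ) + 101) - ((k:ℝ) + 100) * 1) / (((k:ℝ) + 100) * ((k:ℝ) + 101))) =
      2 / (((k:ℝ) + 100) * ((k:ℝ) + 101)) := by ring
    rw [this]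
    apply div_le_div_of_nonneg_left (by norm_num) (by positivity)
    have q1 : (2 * (k:ℝ) + 1) ^ 2 ≤ (σ + 2 * (k + 1) - 1) ^ 2 := by
      apply pow_le_pow_left₀ (by positivity); linarith
    have q2 : (200:ℝ) ^ 2 ≤ t ^ 2 := pow_le_pow_left₀ (by norm_num) ht 2
    nlinarith [sq_nonneg ((k:ℝ) - 33)]
  refine (Finset.sum_le_sum hle).trans ?_
  rw [← Finset.mul_sum, htel]
  have : (0:ℝ) ≤ 1 / ((N:ℝ) + 100) := by positivity
  linarith

lemma gk_re {σ t : ℝ} (k : ℕ) :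
    (gk k (σ + t * I)).re = 1 / (2 * ((k:ℝ) + 1)) - (σ + 2 * (k + 1)) / ((σ + 2 * (k + 1)) ^ 2 + t ^ 2) := by
  have e : (σ + t * I : ℂ) + ((2 * ((k:ℝ) + 1) : ℝ) : ℂ) = ((σ + 2 * (k + 1) : ℝ) : ℂ) + t * I := by
    push_cast; ring
  rw [gk, sub_re, e]
  congr 1
  · rw [one_div, ← ofReal_inv, ofReal_re, one_div]
  · rw [one_div, inv_re]
    congr 1
    · simp
    · rw [normSq_add_mul_I]

lemma g0_re {σ t : ℝ} (hσ : 0 ≤ σ) (ht : 200 ≤ t) :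
    |(g0 (σ + t * I)).re + Real.log (2 * Real.pi) / 2 - Real.log ((σ + 1) ^ 2 + t ^ 2) / 4| ≤ 1 / 50 := by
  have h1 := (Complex.hasSum_re (g0_hasSum (w := σ + t * I) (by simpa using hσ))).tendsto_sum_nat
  have hharm := Real.tendsto_harmonic_sub_log
  have hQ : Tendsto (fun N : ℕ => Real.log ((σ + 1 + 2 * N) ^ 2 + t ^ 2) / 4 - Real.log N / 2) atTop
      (𝓝 (Real.log 2 / 2)) := by
    have hinv : Tendsto (fun N : ℕ => ((N:ℝ))⁻¹) atTop (𝓝 0) := tendsto_inv_atTop_nhds_zero_nat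
    have h2 : Tendsto (fun N : ℕ => ((σ + 1) * ((N:ℝ))⁻¹ + 2) ^ 2 + (t * ((N:ℝ))⁻¹) ^ 2) atTop
        (𝓝 (((σ + 1) * 0 + 2) ^ 2 + (t * 0) ^ 2)) :=
      (((hinv.const_mul (σ + 1)).add_const 2).pow 2).add ((hinv.const_mul t).pow 2)
    have h3 := (h2.log (by norm_num)).div_const 4
    have e : Real.log (((σ + 1) * 0 + 2) ^ 2 + (t * 0) ^ 2) / 4 = Real.log 2 / 2 := by
      have : ((σ + 1) * 0 + 2) ^ 2 + (t * 0) ^ 2 = (2:ℝ) ^ 2 := by ring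
      rw [this, Real.log_pow]; push_cast; ring
    rw [e] at h3
    refine h3.congr' ?_
    filter_upwards [eventually_gt_atTop 0] with N hN
    have hN0 : (0:ℝ) < N := by exact_mod_cast hN
    have e2 : ((σ + 1) * ((N:ℝ))⁻¹ + 2) ^ 2 + (t * ((N:ℝ))⁻¹) ^ 2 = ((σ + 1 + 2 * N) ^ 2 + t ^ 2) / (N:ℝ) ^ 2 := by
      field_simp
    rw [e2, Real.log_div (by positivity) (by positivity), Real.log_pow]
    push_cast; ring
  have hcomb := ((h1.sub (hharm.div_const 2)).add hQ).sub_const (Real.log ((σ + 1) ^ 2 + t ^ 2) / 4)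
  have habs := hcomb.abs
  have hle := le_of_tendsto' (b := 1 / 50) habs (fun N => by
    have hs := h_sum hσ ht N
    rw [← abs_neg] at hs
    refine le_trans (le_of_eq ?_) hs
    congr 1
    have e3 : ∑ k ∈ Finset.range N, (gk k (σ + t * I)).re = (harmonic N : ℝ) / 2 -
        ∑ k ∈ Finset.range N, (σ + 2 * ((k:ℝ) + 1)) / ((σ + 2 * (k + 1)) ^ 2 + t ^ 2) := by
      simp only [gk_re, Finset.sum_sub_distrib]
      congr 1
      rw [harmonic]; push_cast
      rw [Finset.sum_div]
      refine Finset.sum_congr rfl fun k _ => ?_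
      rw [one_div, mul_inv]; ring
    rw [e3]
    ring)
  refine le_trans (le_of_eq ?_) hle
  congr 1
  rw [sub_re, ofReal_re, gc, Real.log_mul (by norm_num) Real.pi_ne_zero]
  ring

lemma G_bounds {t : ℝ} (ht : 200 ≤ t) :
    (g0 (1 + t * I)).re ≤ Real.log t / 2 - Real.log (2 * Real.pi) / 2 + 1 / 25 ∧
    Real.log t - 3 ≤ (g0 (t * I)).re + (g0 (1 + t * I)).re := by
  have h1 := g0_re (σ := 1) zero_le_one ht
  have h0 := g0_re (σ := 0) le_rfl ht
  rw [abs_le] at h1 h0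
  simp only [ofReal_one, ofReal_zero, zero_add] at h1 h0
  have ht0 : 0 < t := by linarith
  have e : Real.log (t ^ 2) = 2 * Real.log t := by rw [Real.log_pow]; push_cast; ring
  have l1 : 2 * Real.log t ≤ Real.log ((1 + 1) ^ 2 + t ^ 2) := by
    rw [← e]; apply Real.log_le_log (by positivity); nlinarith
  have l0 : 2 * Real.log t ≤ Real.log (1 ^ 2 + t ^ 2) := by
    rw [← e]; apply Real.log_le_log (by positivity); nlinarith
  have u1 : Real.log ((1 + 1) ^ 2 + t ^ 2) ≤ 2 * Real.log t + 1 / 20 := by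
    have : Real.log ((1 + 1) ^ 2 + t ^ 2) - Real.log (t ^ 2) ≤ ((1 + 1) ^ 2 + t ^ 2) / t ^ 2 - 1 := by
      rw [← Real.log_div (by positivity) (by positivity)]
      exact Real.log_le_sub_one_of_pos (by positivity)
    have h3 : ((1 + 1) ^ 2 + t ^ 2) / t ^ 2 - 1 ≤ 1 / 20 := by
      rw [sub_le_iff_le_add, div_le_iff₀ (by positivity)]; nlinarith
    linarith
  have hpi : Real.log (2 * Real.pi) ≤ 21 / 10 := by
    have : Real.log (2 * Real.pi) ≤ Real.log (2 ^ 3) := by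
      apply Real.log_le_log (by positivity); nlinarith [Real.pi_lt_four]
    rw [Real.log_pow] at this
    have := Real.log_two_lt_d9
    push_cast at *
    linarith
  constructor
  · linarith [h1.2]
  · obtain ⟨a1, -⟩ := h1
    obtain ⟨a0, -⟩ := h0
    rw [one_pow] at a0 l0
    generalize Real.log (1 + t ^ 2) = q0 at *
    generalize Real.log ((1 + 1) ^ 2 + t ^ 2) = q1 at *
    generalize Real.log (2 * Real.pi) = q2 at *
    linarith

end ZRH

namespace ZRH
open MeasureTheory Filter Topology Set

/-- weighted prime-power sum -/
noncomputable def PP (L : ℝ) : ℝ := ∑ n ∈ Finset.range (⌊Real.exp L⌋₊ + 1),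
  if n = 0 then 0 else ArithmeticFunction.vonMangoldt n * (Real.exp L / n - 1)

lemma PP_eq (L : ℝ) : (Real.exp L : ℂ) * DD L 1 - DD L 0 = (PP L : ℂ) := by
  rw [DD, DD, PP, Finset.mul_sum, ← Finset.sum_sub_distrib, ofReal_sum]
  refine Finset.sum_congr rfl fun n _ => ?_
  by_cases hn : n = 0
  · subst hn; simp
  rw [LSeries.term_of_ne_zero hn, LSeries.term_of_ne_zero hn, if_neg hn, vM]
  simp only [cpow_one, cpow_zero]
  push_cast
  ring

lemma PP_bound (L t : ℝ) : ‖(Real.exp L : ℂ) * DD L (1 + t * I) - DD L (t * I)‖ ≤ PP L := by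
  rw [DD, DD, PP, Finset.mul_sum, ← Finset.sum_sub_distrib]
  refine (norm_sum_le _ _).trans (Finset.sum_le_sum fun n hn => ?_)
  by_cases h0 : n = 0
  · subst h0; simp
  have hn1 : (n : ℝ) ≤ Real.exp L := by
    have : n ≤ ⌊Real.exp L⌋₊ := Nat.lt_succ_iff.mp (Finset.mem_range.mp hn)
    exact (Nat.le_floor_iff (Real.exp_pos L).le).mp this
  have hn0 : (0:ℝ) < n := by positivity
  have hnc : (n:ℂ) ≠ 0 := by exact_mod_cast h0
  rw [LSeries.term_of_ne_zero h0, LSeries.term_of_ne_zero h0, if_neg h0, vM, cpow_add _ _ hnc, cpow_one]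
  have hne : (n:ℂ) ^ (t * I : ℂ) ≠ 0 := by simp [cpow_eq_zero_iff, hnc]
  have e : (Real.exp L : ℂ) * ((ArithmeticFunction.vonMangoldt n : ℂ) / ((n:ℂ) * (n:ℂ) ^ (t * I : ℂ))) -
      (ArithmeticFunction.vonMangoldt n : ℂ) / (n:ℂ) ^ (t * I : ℂ) =
      ((ArithmeticFunction.vonMangoldt n * (Real.exp L / n - 1) : ℝ) : ℂ) / (n:ℂ) ^ (t * I : ℂ) := by
    push_cast
    field_simp
  rw [e, norm_div, Complex.norm_real, norm_natCast_cpow_of_pos (Nat.pos_of_ne_zero h0)]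
  simp only [mul_re, ofReal_re, I_re, mul_zero, ofReal_im, zero_mul, sub_self, Real.rpow_zero, div_one]
  rw [Real.norm_of_nonneg]
  refine mul_nonneg ArithmeticFunction.vonMangoldt_nonneg ?_
  rw [sub_nonneg, one_le_div hn0]; exact hn1

lemma PP_upper (RH : RiemannHypothesis) {L : ℝ} (hL : 0 < L) :
    PP L ≤ Real.exp L * (L - Real.eulerMascheroniConstant - 1) + Real.log (2 * Real.pi) +
      2 * Real.exp (L / 2) * (Real.eulerMascheroniConstant / 2 + 1 - Real.log 2 - Real.log Real.pi / 2) + 1 := by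
  have h := FI RH hL 0 (w := 1) (v := 0) (by simp) (by simp)
  have hf : ff 1 = ((Real.eulerMascheroniConstant / 2 + 1 - Real.log 2 - Real.log Real.pi / 2 : ℝ) : ℂ) := by
    rw [ff, zz_one, g0_one]; push_cast; ring
  have hE : EE L 1 0 = ((Real.exp L - 1 : ℝ) : ℂ) := by
    rw [EE_ne zero_ne_one]; push_cast; simp [div_neg]
  have hV : VV L 1 0 = ((Real.exp L * Real.eulerMascheroniConstant + PP L - Real.exp L * L + (Real.exp L - 1) + gc : ℝ) : ℂ) := by
    rw [VV, hE, EE_same, zz_one, g0_zero]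
    have := PP_eq L
    simp only [one_mul, zero_mul, Complex.exp_zero]
    push_cast at this ⊢
    rw [← this]
    ring
  rw [hV, hf] at h
  simp only [zero_mul, neg_zero, Complex.exp_zero, one_mul, conj_ofReal, ofReal_re] at h
  rw [← ofReal_add, Complex.norm_real, Real.norm_eq_abs] at h
  have h2 := (le_abs_self _).trans h
  rw [gc] at h2
  rw [Real.log_mul (by norm_num) Real.pi_ne_zero]
  linarith

lemma R_upper (RH : RiemannHypothesis) {L t : ℝ} (hL : 0 < L) (ht : 0 < t)
    (hX : 1 + 2 * Real.exp L ≤ t) :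
    (deriv riemannZeta (1 + t * I) / riemannZeta (1 + t * I)).re * (Real.exp (L / 2) - 1) ^ 2 ≤
      PP L + 2 * Real.exp (L / 2) * (g0 (1 + t * I)).re -
      ((g0 (t * I)).re + (g0 (1 + t * I)).re) + 2 := by
  have h := FI RH hL t (w := 1 + t * I) (v := t * I) rfl rfl
  have hP := PP_bound L t
  have htc : (t:ℂ) ≠ 0 := by exact_mod_cast ht.ne'
  have hw1 : (1 + t * I : ℂ) ≠ 1 := by
    intro h; simp [ht.ne'] at h
  have hv1 : (t * I : ℂ) ≠ 1 := by
    intro h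
    have := congrArg re h
    simp at this
  have hz : riemannZeta (1 + t * I) ≠ 0 := riemannZeta_ne_zero_of_one_le_re (by simp)
  have hzz := zz_eq hw1 hz
  set R := deriv riemannZeta (1 + t * I) / riemannZeta (1 + t * I) with hR
  set u := Real.exp (L / 2) with hu
  have huX : Real.exp L = u ^ 2 := by
    rw [hu, ← Real.exp_nat_mul]; congr 1; push_cast; ring
  set Q := (Real.exp L : ℂ) * DD L (1 + t * I) - DD L (t * I) with hQ
  set y := exp (-(t * I * L)) with hy
  have hyn : ‖y‖ = 1 := by rw [hy, Complex.norm_exp]; simp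
  have hyi : y * exp (t * I * L) = 1 := by rw [hy, ← Complex.exp_add]; simp
  have e1 : exp ((1 + t * I) * L) = exp (t * I * L) * (Real.exp L : ℂ) := by
    rw [ofReal_exp, ← Complex.exp_add]; congr 1; ring
  set err := y * (Real.exp L : ℂ) / (t * I) + (1 - y * (Real.exp L : ℂ)) / (t * I - 1) with herr
  have key : y * VV L (1 + t * I) (t * I) = (Real.exp L : ℂ) * R + Q + g0 (t * I) + err := by
    rw [VV, EE_ne hw1, EE_ne hv1, hzz, e1, hQ, herr]
    have e2 : exp (1 * L : ℂ) = (Real.exp L : ℂ) := by rw [one_mul, ofReal_exp]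
    rw [e2]
    have e3 : (1 + t * I - 1 : ℂ) = t * I := by ring
    rw [e3]
    set x := exp (t * I * L) with hx
    set X := (Real.exp L : ℂ)
    have l1 : ∀ A : ℂ, y * (x * A) = A := fun A => by rw [← mul_assoc, hyi, one_mul]
    have : y * (x * X * (R + 1 / (t * I) + DD L (1 + t * I)) - (x * X - X) / (t * I) - x * DD L (t * I) +
      (x - X) / (t * I - 1) + x * g0 (t * I)) =
      (y * x) * (X * (R + 1 / (t * I) + DD L (1 + t * I)) - X / (t * I) - DD L (t * I)
       + 1 / (t * I - 1) + g0 (t * I)) + y * X / (t * I) - y * X / (t * I - 1) := by ring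
    rw [this, hyi]
    ring
  have hX0 : 0 < Real.exp L := Real.exp_pos L
  have herrn : ‖err‖ ≤ 1 := by
    have a1 : ‖y * (Real.exp L : ℂ) / (t * I)‖ = Real.exp L / t := by
      rw [norm_div, norm_mul, norm_mul, hyn, Complex.norm_real, Complex.norm_real, norm_I,
        Real.norm_of_nonneg hX0.le, Real.norm_of_nonneg ht.le]; ring
    have a2 : ‖(1 - y * (Real.exp L : ℂ)) / (t * I - 1)‖ ≤ (1 + Real.exp L) / t := by
      rw [norm_div]
      refine div_le_div₀ (by positivity) ?_ ht ?_
      · refine (norm_sub_le _ _).trans ?_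
        rw [norm_mul, hyn, Complex.norm_real, Real.norm_of_nonneg hX0.le, norm_one, one_mul]
      · have := abs_im_le_norm (t * I - 1 : ℂ)
        simp at this
        exact (le_abs_self t).trans this
    refine (norm_add_le _ _).trans ?_
    rw [a1]
    refine (add_le_add le_rfl a2).trans ?_
    rw [← add_div, div_le_one ht]
    linarith
  rw [key] at h
  have hff : (ff (1 + t * I)).re = R.re + (g0 (1 + t * I)).re := by
    rw [ff, hzz]
    simp
  have h2 := (re_le_norm _).trans h
  simp only [add_re, conj_re, hff, re_ofReal_mul] at h2
  have h3 : -PP L ≤ Q.re := by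
    have := (abs_re_le_norm Q).trans hP
    exact (abs_le.mp this).1
  have h4 : -1 ≤ err.re := by
    have := (abs_re_le_norm err).trans herrn
    exact (abs_le.mp this).1
  rw [huX] at h2
  nlinarith

lemma rational_ineq {u : ℝ} (hu : 23 / 2 ≤ u) :
    0 ≤ (u - 1) ^ 2 * (2 * (-(u / (u - 5 / 2) - (u - 5 / 2) / u) / 2) +
      (8 * (0.6931 + (-(u / (u - 5 / 2) - (u - 5 / 2) / u) / 2)) - 8.6) / (2 * u - 5) + 1) +
      7 / 2 * 0.6931 * (8 * u - 2) / (2 * u - 5) -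
      (-u ^ 2 + (0.6931 + 1.1) + 2 * u - u * (3 * 0.6931 + 2 * 1.1) + 1 + u * (2 * u - 5) +
        2 * u * (1 / 25) - (2 * u - 5) + 3 + 2) + 1 / 2 * (u - 1) := by
  obtain ⟨s, rfl⟩ : ∃ s, u = s + 23 / 2 := ⟨u - 23 / 2, by ring⟩
  have hs : 0 ≤ s := by linarith
  have h1 : s + 9 ≠ 0 := by positivity
  have h2 : s + 23 / 2 ≠ 0 := by positivity
  have h3 : 2 * s + 18 ≠ 0 := by positivity
  have e1 : s + 23 / 2 - 5 / 2 = s + 9 := by ring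
  have e2 : 2 * (s + 23 / 2) - 5 = 2 * (s + 9) := by ring
  rw [e1, e2]
  have key : ∀ T : ℝ, 0 ≤ T * ((s + 23 / 2) * (2 * (s + 9)) ^ 2) → 0 ≤ T := by
    intro T hT
    have : 0 < (s + 23 / 2) * (2 * (s + 9)) ^ 2 := by positivity
    exact nonneg_of_mul_nonneg_left hT this
  apply key
  field_simp
  ring_nf
  positivity

lemma final_real {u c v p γ lam P G1 G2 : ℝ} (hu1 : 23 / 2 ≤ u) (hc2 : 0.6931471803 ≤ c)
    (hpi : 1.1 ≤ p) (hγ1 : 1 / 2 ≤ γ) (hlu7 : 7 / 2 * c ≤ v)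
    (hrat : 0 ≤ (u - 1) ^ 2 * (2 * lam + (8 * (0.6931 + lam) - 8.6) / (2 * u - 5) + 1) +
      7 / 2 * 0.6931 * (8 * u - 2) / (2 * u - 5) -
      (-u ^ 2 + (0.6931 + 1.1) + 2 * u - u * (3 * 0.6931 + 2 * 1.1) + 1 + u * (2 * u - 5) +
        2 * u * (1 / 25) - (2 * u - 5) + 3 + 2) + 1 / 2 * (u - 1))
    (hP : P ≤ u ^ 2 * (2 * v - γ - 1) + (c + p) + 2 * u * (γ / 2 + 1 - c - p / 2) + 1)
    (hG1 : G1 ≤ (2 * u - 5) / 2 - (c + p) / 2 + 1 / 25)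
    (hG2 : 2 * u - 5 - 3 ≤ G2) :
    P + 2 * u * G1 - G2 + 2 ≤
      (u - 1) ^ 2 * (2 * (v + lam) + 1 - γ + (8 * (c + v + lam) - 8.6) / (2 * u - 5)) := by
  have hd : 0 < 2 * u - 5 := by linarith
  have hdn := hd.ne'
  have hu12 : 0 ≤ (u - 1) ^ 2 := sq_nonneg _
  have hG1' := mul_le_mul_of_nonneg_left hG1 (by linarith : 0 ≤ 2 * u)
  have e0 : (u - 1) ^ 2 * (8 * v / (2 * u - 5)) = 4 * u * v - 2 * v + v * ((8 * u - 2) / (2 * u - 5)) := by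
    have hw : (2 * u - 5) * (2 * u - 5)⁻¹ = 1 := mul_inv_cancel₀ hdn
    rw [div_eq_mul_inv, div_eq_mul_inv]
    linear_combination (4 * u - 2) * v * hw
  have e1 : (u - 1) ^ 2 * (2 * (v + lam) + 1 - γ + (8 * (c + v + lam) - 8.6) / (2 * u - 5)) =
      (u - 1) ^ 2 * (2 * lam + (8 * (0.6931 + lam) - 8.6) / (2 * u - 5) + 1)
      + 2 * u ^ 2 * v + v * ((8 * u - 2) / (2 * u - 5)) - γ * (u - 1) ^ 2
      + (u - 1) ^ 2 * (8 * (c - 0.6931) / (2 * u - 5)) := by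
    linear_combination e0
  rw [e1]
  have hc3 : (0.6931 : ℝ) ≤ c := by norm_num at hc2 ⊢; linarith
  have f1 : 7 / 2 * 0.6931 * (8 * u - 2) / (2 * u - 5) ≤ v * ((8 * u - 2) / (2 * u - 5)) := by
    rw [mul_div_assoc]
    have : 0 ≤ (8 * u - 2) / (2 * u - 5) := div_nonneg (by linarith) hd.le
    exact mul_le_mul_of_nonneg_right (by linarith) this
  have f2 : 0 ≤ (u - 1) ^ 2 * (8 * (c - 0.6931) / (2 * u - 5)) :=
    mul_nonneg hu12 (div_nonneg (by linarith) hd.le)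
  have f3a : 0 ≤ (3 * u - 1) * (c - 0.6931) := mul_nonneg (by linarith) (by linarith)
  have f3b : 0 ≤ (2 * u - 1) * (p - 1.1) := mul_nonneg (by linarith) (by linarith)
  have f4 : 0 ≤ (γ - 1 / 2) * (u - 1) := mul_nonneg (by linarith) (by linarith)
  linarith

end ZRH

theorem re_zeta_logDeriv_upper (RH : RiemannHypothesis) (t : ℝ) (ht : Real.exp 18 ≤ t) :
    (deriv riemannZeta (1 + t * I) / riemannZeta (1 + t * I)).re ≤
      2 * Real.log (Real.log t) + 1 - Real.eulerMascheroniConstant - Real.log 4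
        + 8 * Real.log (Real.log t) / Real.log t - 8.6 / Real.log t := by
  have ht0 : 0 < t := (Real.exp_pos 18).trans_le ht
  set l := Real.log t with hl
  have hl18 : 18 ≤ l := by rw [hl, Real.le_log_iff_exp_le ht0]; exact ht
  set u := (l + 5) / 2 with hu
  have hlu : l = 2 * u - 5 := by rw [hu]; ring
  have hu1 : 23 / 2 ≤ u := by rw [hu]; linarith
  have hu0 : 0 < u := by linarith
  set L := 2 * Real.log u with hL
  have hlogu : 0 < Real.log u := Real.log_pos (by linarith)
  have hL0 : 0 < L := by rw [hL]; linarith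
  have hL2 : Real.exp (L / 2) = u := by
    rw [hL, mul_div_cancel_left₀ _ (by norm_num : (2:ℝ) ≠ 0), Real.exp_log hu0]
  have hLX : Real.exp L = u ^ 2 := by
    rw [← hL2, ← Real.exp_nat_mul]; congr 1; push_cast; ring
  have hexp : t = Real.exp (l / 2) ^ 2 := by
    rw [← Real.exp_nat_mul]
    push_cast
    rw [mul_div_cancel₀ _ (by norm_num : (2:ℝ) ≠ 0), hl, Real.exp_log ht0]
  have hq := Real.quadratic_le_exp_of_nonneg (x := l / 2) (by linarith)
  have ht1 : (1 + l / 2 + (l / 2) ^ 2 / 2) ^ 2 ≤ t := by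
    rw [hexp]; exact pow_le_pow_left₀ (by positivity) hq 2
  have hq2 : 50 ≤ 1 + l / 2 + (l / 2) ^ 2 / 2 := by nlinarith
  have ht2 : 50 * (1 + l / 2 + (l / 2) ^ 2 / 2) ≤ t := by nlinarith
  have hX : 1 + 2 * Real.exp L ≤ t := by rw [hLX, hu]; nlinarith
  have ht200 : 200 ≤ t := by linarith
  have hR := ZRH.R_upper RH hL0 ht0 hX
  have hP := ZRH.PP_upper RH hL0
  obtain ⟨hG1, hG2⟩ := ZRH.G_bounds ht200
  rw [hL2] at hR hP
  rw [hLX] at hP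
  set R := (deriv riemannZeta (1 + t * I) / riemannZeta (1 + t * I)).re with hRdef
  have hγ1 := Real.one_half_lt_eulerMascheroniConstant
  set γ := Real.eulerMascheroniConstant with hγ
  have hc2 := Real.log_two_gt_d9
  have hpi : (1.1 : ℝ) ≤ Real.log Real.pi := by
    rw [Real.le_log_iff_exp_le Real.pi_pos]
    have h1 : Real.exp 1.1 = Real.exp 1 * Real.exp 0.1 := by rw [← Real.exp_add]; norm_num
    have h2 : Real.exp 0.1 ≤ 1 / (1 - 0.1) := by
      have := Real.one_sub_le_exp_neg (0.1 : ℝ)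
      rw [Real.exp_neg] at this
      rw [le_div_iff₀ (by norm_num)]
      have h3 := Real.exp_pos (0.1 : ℝ)
      calc Real.exp 0.1 * (1 - 0.1) ≤ Real.exp 0.1 * (Real.exp 0.1)⁻¹ := by gcongr
        _ = 1 := mul_inv_cancel₀ h3.ne'
    have h4 := Real.exp_one_lt_d9
    have h5 := Real.pi_gt_d2
    rw [h1]
    have h6 : Real.exp 1 * Real.exp 0.1 ≤ 2.7182818286 * (1 / (1 - 0.1)) := by gcongr
    refine h6.trans (le_trans ?_ h5.le)
    norm_num
  have hl2pi : Real.log (2 * Real.pi) = Real.log 2 + Real.log Real.pi := by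
    rw [Real.log_mul (by norm_num) Real.pi_ne_zero]
  have hl4 : Real.log 4 = 2 * Real.log 2 := by
    rw [show (4:ℝ) = 2 ^ 2 by norm_num, Real.log_pow]; push_cast; ring
  rw [hl2pi] at hP hG1
  -- lower bound for log u
  have hlu7 : 7 / 2 * Real.log 2 ≤ Real.log u := by
    have h1 : Real.log (2 ^ 7) ≤ Real.log (u ^ 2) := by
      apply Real.log_le_log (by norm_num); nlinarith
    rw [Real.log_pow, Real.log_pow] at h1
    push_cast at h1
    linarith
  -- lower bound for log l
  set lam := -(u / (u - 5 / 2) - (u - 5 / 2) / u) / 2 with hlam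
  have hlog : Real.log 2 + Real.log u + lam ≤ Real.log l := by
    have hz0 : 0 < u / (u - 5 / 2) := div_pos hu0 (by linarith)
    have h1 : Real.log (u / (u - 5 / 2)) ≤ Real.sinh (Real.log (u / (u - 5 / 2))) := by
      rw [Real.self_le_sinh_iff]
      apply Real.log_nonneg
      rw [one_le_div (by linarith)]; linarith
    rw [Real.sinh_log hz0, inv_div, Real.log_div hu0.ne' (by linarith)] at h1
    have h2 : Real.log l = Real.log 2 + Real.log (u - 5 / 2) := by
      rw [← Real.log_mul (by norm_num) (by linarith)]; congr 1; rw [hlu]; ring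
    rw [h2, hlam]
    linarith
  have hrat := ZRH.rational_ineq hu1
  rw [← hlam] at hrat
  have hd : 0 < 2 * u - 5 := by linarith
  have hu12 : 0 < (u - 1) ^ 2 := by
    have : 0 < u - 1 := by linarith
    positivity
  refine le_of_mul_le_mul_right ?_ hu12
  -- lower bound of the target
  set c := Real.log 2 with hc
  set v := Real.log u with hv
  set p := Real.log Real.pi with hp
  have hT : (u - 1) ^ 2 * (2 * (v + lam) + 1 - γ + (8 * (c + v + lam) - 8.6) / (2 * u - 5)) ≤
      (2 * Real.log l + 1 - γ - Real.log 4 + 8 * Real.log l / l - 8.6 / l) * (u - 1) ^ 2 := by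
    rw [mul_comm ((u - 1) ^ 2)]
    apply mul_le_mul_of_nonneg_right _ hu12.le
    rw [hl4]
    have h1 : (8 * (c + v + lam) - 8.6) / (2 * u - 5) ≤ 8 * Real.log l / l - 8.6 / l := by
      rw [← sub_div, ← hlu]
      have : 0 < l := by linarith
      gcongr
    linarith
  refine hR.trans (le_trans ?_ hT)
  have hP' : ZRH.PP L ≤ u ^ 2 * (2 * v - γ - 1) + (c + p) + 2 * u * (γ / 2 + 1 - c - p / 2) + 1 := hP
  rw [← hl, hlu] at hG1 hG2
  exact ZRH.final_real hu1 hc2.le hpi hγ1.le hlu7 hrat hP' hG1 hG2
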